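/- arXiv:2307.16291 — 4 statements merged into one kernel-verified Lean document; each statement's English description precedes it below -/
import Mathlib

section
/- Let Ω ⊆ ℝⁿ be open, 1 ≤ p < ∞, and let w be any weight. Let f ∈ RBV^p(Ω,w) be locally integrable on Ω. Let φ ∈ C_c^∞(B(0,1)) be a nonnegative, radially decreasing function with ∫φ = 1, and for R > 0 set φ_R(x) = R^{-n} φ(x/R). Then for every open set Ω₀ compactly contained in Ω and every 0 < R < d(Ω₀, Ω^c)/(6√n), and every 1 ≤ j ≤ n, one has ‖∂_j(φ_R * f)‖_{L^p(Ω₀,w)} ≤ C V_p(f; Ω, w), where C depends only on n, p, and φ (and not on R or Ω₀). -/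
open MeasureTheory Metric Set ENNReal Filter

noncomputable section

/-- `n`-dimensional Euclidean space. -/
abbrev Eu (n : ℕ) := EuclideanSpace ℝ (Fin n)

/-- The oscillation `osc_s(f) = sup_{x,y ∈ s} |f x - f y|`, valued in `ℝ≥0∞`. -/
noncomputable def oscOn {n : ℕ} (f : Eu n → ℝ) (s : Set (Eu n)) : ℝ≥0∞ :=
  ⨆ x ∈ s, ⨆ y ∈ s, ENNReal.ofReal |f x - f y|

/-- The measure `w(x) dx` associated to a weight `w`. -/
noncomputable def wMeasure (n : ℕ) (w : Eu n → ℝ) : Measure (Eu n) :=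
  volume.withDensity fun x => ENNReal.ofReal (w x)

/-- A weight: a nonnegative locally integrable function. -/
def IsWeight (n : ℕ) (w : Eu n → ℝ) : Prop :=
  (∀ x, 0 ≤ w x) ∧ LocallyIntegrable w volume

/-- A countable collection of pairwise disjoint open balls contained in `Ω`
(balls of radius `0` are empty and are allowed as padding, so that finite
collections are included). -/
structure BallPack (n : ℕ) (Ω : Set (Eu n)) where
  c : ℕ → Eu n
  r : ℕ → ℝ
  r_nonneg : ∀ k, 0 ≤ r k
  ball_subset : ∀ k, ball (c k) (r k) ⊆ Ω
  disj : Pairwise fun i j => Disjoint (ball (c i) (r i)) (ball (c j) (r j))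

/-- The sum `Σ_k (osc_{B_k}(f)/r_k)^p w(B_k)` for a collection of disjoint balls. -/
noncomputable def packSum {n : ℕ} {Ω : Set (Eu n)} (p : ℝ) (f w : Eu n → ℝ)
    (D : BallPack n Ω) : ℝ≥0∞ :=
  ∑' k, (oscOn f (ball (D.c k) (D.r k)) / ENNReal.ofReal (D.r k)) ^ p
      * wMeasure n w (ball (D.c k) (D.r k))

/-- The weighted Riesz `p`-variation `V_p(f; Ω, w)`. -/
noncomputable def rieszVar {n : ℕ} (p : ℝ) (f : Eu n → ℝ) (Ω : Set (Eu n))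
    (w : Eu n → ℝ) : ℝ≥0∞ :=
  ⨆ D : BallPack n Ω, packSum p f w D ^ (1 / p)

/-- `w` is a Muckenhoupt `A_p` weight with `A_p` constant at most `Cw`
(stated for both `p = 1` and `p > 1`; the first clause, positivity of `w` on balls,
rules out the degenerate weight vanishing on a ball). -/
def IsMuckenhoupt (n : ℕ) (p : ℝ) (w : Eu n → ℝ) (Cw : ℝ) : Prop :=
  (∀ (x : Eu n) (r : ℝ), 0 < r → 0 < ∫⁻ y in ball x r, ENNReal.ofReal (w y)) ∧
  (p = 1 → ∀ (x : Eu n) (r : ℝ), 0 < r →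
      essSup (fun y => (ENNReal.ofReal (w y))⁻¹) (volume.restrict (ball x r)) *
        (⨍⁻ y in ball x r, ENNReal.ofReal (w y) ∂volume) ≤ ENNReal.ofReal Cw) ∧
  (1 < p → ∀ (x : Eu n) (r : ℝ), 0 < r →
      (⨍⁻ y in ball x r, ENNReal.ofReal (w y) ∂volume) *
        (⨍⁻ y in ball x r, ENNReal.ofReal (w y) ^ (1 / (1 - p)) ∂volume) ^ (p - 1)
        ≤ ENNReal.ofReal Cw)

/-- `w ∈ A_p`. -/
def MemAp (n : ℕ) (p : ℝ) (w : Eu n → ℝ) : Prop :=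
  ∃ Cw : ℝ, IsMuckenhoupt n p w Cw

/-- `r_w = inf { q > 1 : w ∈ A_q }`. -/
noncomputable def rwExp (n : ℕ) (w : Eu n → ℝ) : ℝ :=
  sInf {q : ℝ | 1 < q ∧ MemAp n q w}

/-- `g` is the weak (distributional) `j`-th partial derivative of `f` on the open set `Ω`. -/
def HasWeakPartialDeriv (n : ℕ) (Ω : Set (Eu n)) (f g : Eu n → ℝ) (j : Fin n) : Prop :=
  ∀ φ : Eu n → ℝ, ContDiff ℝ (⊤ : ℕ∞) φ → HasCompactSupport φ → tsupport φ ⊆ Ω →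
    ∫ x in Ω, f x * fderiv ℝ φ x (EuclideanSpace.single j 1) = - ∫ x in Ω, g x * φ x

/-- The local Lipschitz constant `L_f(x) = limsup_{y → x} |f x - f y| / |x - y|`. -/
noncomputable def localLip {n : ℕ} (f : Eu n → ℝ) (x : Eu n) : ℝ≥0∞ :=
  Filter.limsup (fun y => ENNReal.ofReal (|f x - f y| / dist x y)) (nhdsWithin x {x}ᶜ)

/-- Convolution `(g ⋆ f)(x) = ∫ g(y) f(x - y) dy`. -/
noncomputable def convWith {n : ℕ} (g f : Eu n → ℝ) (x : Eu n) : ℝ :=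
  ∫ y, g y * f (x - y)

/-- Variable exponent modular for `ℝ≥0∞`-valued functions: `∫_Ω f(x)^{p(x)} dx`. -/
noncomputable def varModularE {n : ℕ} (p : Eu n → ℝ) (Ω : Set (Eu n))
    (f : Eu n → ℝ≥0∞) : ℝ≥0∞ :=
  ∫⁻ x in Ω, f x ^ p x

/-- Variable exponent Luxemburg norm for `ℝ≥0∞`-valued functions. -/
noncomputable def varLpNormE {n : ℕ} (p : Eu n → ℝ) (Ω : Set (Eu n))
    (f : Eu n → ℝ≥0∞) : ℝ≥0∞ :=
  sInf (ENNReal.ofReal ''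
    {lam : ℝ | 0 < lam ∧ varModularE p Ω (fun x => f x / ENNReal.ofReal lam) ≤ 1})

/-- Variable exponent Luxemburg norm `‖f‖_{L^{p(·)}(Ω)}`. -/
noncomputable def varLpNorm {n : ℕ} (p : Eu n → ℝ) (Ω : Set (Eu n)) (f : Eu n → ℝ) : ℝ≥0∞ :=
  varLpNormE p Ω fun x => ENNReal.ofReal |f x|

/-- `p(·)` is log-Hölder continuous on `Ω`, locally and at infinity. -/
def LogHolder {n : ℕ} (p : Eu n → ℝ) (Ω : Set (Eu n)) : Prop :=
  (∃ C₀ > (0:ℝ), ∀ x ∈ Ω, ∀ y ∈ Ω, dist x y < 1/2 →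
      |p x - p y| ≤ C₀ / (-Real.log (dist x y))) ∧
  (∃ pinf : ℝ, ∃ Cinf > (0:ℝ), ∀ x ∈ Ω,
      |p x - pinf| ≤ Cinf / Real.log (Real.exp 1 + ‖x‖))

/-- The harmonic mean `p_B` of the exponent `p(·)` on a set `B`: `1/p_B = ⨍_B 1/p(x) dx`. -/
noncomputable def harmMean {n : ℕ} (p : Eu n → ℝ) (B : Set (Eu n)) : ℝ :=
  (⨍ x in B, (p x)⁻¹)⁻¹

/-- The variable exponent Riesz modular
`V_𝒟^{p(·)}(f;Ω) = Σ_k (osc_{B_k}(f)/r_k)^{p_{B_k}} ‖χ_{B_k}‖_{p(·)}^{p_{B_k}}`. -/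
noncomputable def varRieszModular {n : ℕ} (p : Eu n → ℝ) (Ω : Set (Eu n))
    (D : BallPack n Ω) (f : Eu n → ℝ) : ℝ≥0∞ :=
  ∑' k, (oscOn f (ball (D.c k) (D.r k)) / ENNReal.ofReal (D.r k))
          ^ harmMean p (ball (D.c k) (D.r k))
      * varLpNorm p Ω ((ball (D.c k) (D.r k)).indicator fun _ => (1:ℝ))
          ^ harmMean p (ball (D.c k) (D.r k))

/-- The Luxemburg-type norm `‖f‖_{RBV_𝒟^{p(·)}(Ω)}`. -/
noncomputable def varRBVDNorm {n : ℕ} (p : Eu n → ℝ) (Ω : Set (Eu n))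
    (D : BallPack n Ω) (f : Eu n → ℝ) : ℝ≥0∞ :=
  sInf (ENNReal.ofReal ''
    {lam : ℝ | 0 < lam ∧ varRieszModular p Ω D (fun x => f x / lam) ≤ 1})

/-- `‖f‖_{RBV^{p(·)}(Ω)} = sup_𝒟 ‖f‖_{RBV_𝒟^{p(·)}(Ω)}`. -/
noncomputable def varRBVNorm {n : ℕ} (p : Eu n → ℝ) (Ω : Set (Eu n)) (f : Eu n → ℝ) : ℝ≥0∞ :=
  ⨆ D : BallPack n Ω, varRBVDNorm p Ω D f

/-- The operator `G_𝒟 f = Σ_k (osc_{B_k}(f)/r_k) χ_{B_k}`. -/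
noncomputable def GD {n : ℕ} {Ω : Set (Eu n)} (f : Eu n → ℝ) (D : BallPack n Ω)
    (x : Eu n) : ℝ≥0∞ :=
  ∑' k, (ball (D.c k) (D.r k)).indicator
      (fun _ => oscOn f (ball (D.c k) (D.r k)) / ENNReal.ofReal (D.r k)) x

end

lemma le_oscOn {n : ℕ} (f : Eu n → ℝ) {s : Set (Eu n)} {x y : Eu n} (hx : x ∈ s) (hy : y ∈ s) :
    ENNReal.ofReal |f x - f y| ≤ oscOn f s :=
  le_iSup₂_of_le x hx (le_iSup₂_of_le y hy le_rfl)

lemma oscOn_mono {n : ℕ} (f : Eu n → ℝ) {s t : Set (Eu n)} (h : s ⊆ t) :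
    oscOn f s ≤ oscOn f t :=
  iSup₂_le fun _ hx => iSup₂_le fun _ hy => le_oscOn f (h hx) (h hy)

lemma norm_convWith_sub_le {n : ℕ} {ψ f : Eu n → ℝ} {Λ : NNReal} (hψ : LipschitzWith Λ ψ)
    {R M : ℝ} (hsupp : ∀ y, R ≤ ‖y‖ → ψ y = 0) {x x' : Eu n} (hx' : dist x' x ≤ R) (hR : 0 < R)
    (hf : IntegrableOn f (ball x (2 * R)) volume)
    (hM : ∀ y ∈ ball x (2 * R), |f y - f x| ≤ M) :
    ‖convWith ψ f x' - convWith ψ f x‖ ≤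
      Λ * M * (volume (ball x (2 * R))).toReal * ‖x' - x‖ := by
  have hconv : ∀ z, convWith ψ f z = ∫ y, ψ (z - y) * f y := by
    intro z
    rw [convWith, ← integral_sub_left_eq_self _ volume z]
    simp
  have hzero : ∀ z, dist z x ≤ R → ∀ y, y ∉ ball x (2 * R) → ψ (z - y) = 0 := by
    intro z hz y hy
    apply hsupp
    rw [mem_ball, not_lt] at hy
    rw [← dist_eq_norm]
    linarith [dist_triangle y z x, dist_comm y z]
  have hcs : HasCompactSupport ψ :=
    HasCompactSupport.of_support_subset_isCompact (isCompact_closedBall 0 R) fun y hy => by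
      rw [mem_closedBall_zero_iff]
      by_contra! h
      exact hy (hsupp y h.le)
  obtain ⟨B, hB⟩ := hcs.exists_bound_of_continuous hψ.continuous
  have hint : Integrable ψ := hψ.continuous.integrable_of_hasCompactSupport hcs
  have hI1 : ∀ z, dist z x ≤ R → Integrable (fun y => ψ (z - y) * f y) := by
    intro z hz
    have h1 : IntegrableOn (fun y => ψ (z - y) * f y) (ball x (2 * R)) := by
      refine Integrable.bdd_mul hf (c := B) ?_ (ae_of_all _ fun y => hB _)
      exact (hψ.continuous.comp (continuous_const.sub continuous_id)).aestronglyMeasurable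
    refine (integrableOn_iff_integrable_of_support_subset ?_).1 h1
    intro y hy
    by_contra h
    exact hy (by simp [hzero z hz y h])
  have hI2 : ∀ z, Integrable (fun y => ψ (z - y) * f x) := fun z =>
    (hint.comp_sub_left z).mul_const _
  have hconst : ∀ z, ∫ y, ψ (z - y) * f x = (∫ y, ψ y) * f x := by
    intro z
    rw [integral_mul_const, integral_sub_left_eq_self ψ volume z]
  have hx : dist x x ≤ R := by simpa using hR.le
  have key : convWith ψ f x' - convWith ψ f x =
      ∫ y in ball x (2 * R), (ψ (x' - y) - ψ (x - y)) * (f y - f x) := by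
    rw [setIntegral_eq_integral_of_forall_compl_eq_zero
      (fun y hy => by rw [hzero x' hx' y hy, hzero x hx y hy]; simp)]
    have e1 : ∀ y, (ψ (x' - y) - ψ (x - y)) * (f y - f x) =
        (ψ (x' - y) * f y - ψ (x' - y) * f x) - (ψ (x - y) * f y - ψ (x - y) * f x) :=
      fun y => by ring
    simp_rw [e1]
    have e2 := integral_sub ((hI1 x' hx').sub (hI2 x')) ((hI1 x hx).sub (hI2 x))
    simp only [Pi.sub_apply] at e2
    rw [e2, integral_sub (hI1 x' hx') (hI2 x'), integral_sub (hI1 x hx) (hI2 x),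
      hconst, hconst, hconv, hconv]
    ring
  rw [key]
  refine (norm_setIntegral_le_of_norm_le_const (C := Λ * ‖x' - x‖ * M) measure_ball_lt_top
    fun y hy => ?_).trans (le_of_eq (by rw [Measure.real]; ring))
  rw [norm_mul]
  have h1 := hψ.norm_sub_le (x' - y) (x - y)
  rw [sub_sub_sub_cancel_right] at h1
  exact mul_le_mul h1 (hM y hy) (norm_nonneg _) (by positivity)

lemma enorm_fderiv_convWith_le {n : ℕ} {ψ f : Eu n → ℝ} {Λ : NNReal} (hΛ : 0 < Λ)
    (hψ : LipschitzWith Λ ψ) {R : ℝ} (hR : 0 < R) (hsupp : ∀ y, R ≤ ‖y‖ → ψ y = 0) {x : Eu n}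
    (hf : IntegrableOn f (ball x (2 * R)) volume) (v : Eu n) (hv : ‖v‖ ≤ 1) :
    ‖fderiv ℝ (convWith ψ f) x v‖ₑ ≤
      Λ * volume (ball x (2 * R)) * oscOn f (ball x (2 * R)) := by
  by_cases hosc : oscOn f (ball x (2 * R)) = ⊤
  · have hv0 : volume (ball x (2 * R)) ≠ 0 := (measure_ball_pos _ _ (by positivity)).ne'
    have hΛ0 : (Λ : ℝ≥0∞) ≠ 0 := by simpa using hΛ.ne'
    rw [hosc, ENNReal.mul_top (mul_ne_zero hΛ0 hv0)]
    exact le_top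
  · set M := (oscOn f (ball x (2 * R))).toReal
    have hM : ∀ y ∈ ball x (2 * R), |f y - f x| ≤ M := fun y hy =>
      (ENNReal.ofReal_le_iff_le_toReal hosc).1
        (le_oscOn f hy (mem_ball_self (by positivity)))
    have h : ‖fderiv ℝ (convWith ψ f) x‖ ≤ Λ * M * (volume (ball x (2 * R))).toReal := by
      refine norm_fderiv_le_of_lip' ℝ (by positivity) ?_
      filter_upwards [closedBall_mem_nhds x hR] with x' hx'
      exact norm_convWith_sub_le hψ hsupp hx' hR hf hM
    have h2 : ‖fderiv ℝ (convWith ψ f) x v‖ ≤ Λ * M * (volume (ball x (2 * R))).toReal :=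
      (ContinuousLinearMap.le_opNorm_of_le _ hv).trans (by simpa using h)
    rw [← ofReal_norm]
    refine (ENNReal.ofReal_le_ofReal h2).trans (le_of_eq ?_)
    rw [ENNReal.ofReal_mul (by positivity), ENNReal.ofReal_mul (by positivity),
      ENNReal.ofReal_toReal hosc, ENNReal.ofReal_toReal measure_ball_lt_top.ne,
      ENNReal.ofReal_coe_nnreal]
    ring

lemma lipschitzWith_rescale {n : ℕ} {φ : Eu n → ℝ} {L : NNReal} (hφ : LipschitzWith L φ)
    {R : ℝ} (hR : 0 < R) :
    LipschitzWith (Real.toNNReal (L * R ^ (-(n : ℝ)) * R⁻¹))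
      (fun y => R ^ (-(n : ℝ)) * φ (R⁻¹ • y)) := by
  refine LipschitzWith.of_dist_le_mul fun x y => ?_
  rw [Real.coe_toNNReal _ (by positivity), Real.dist_eq, ← mul_sub, abs_mul,
    abs_of_pos (Real.rpow_pos_of_pos hR _)]
  have h := hφ.dist_le_mul (R⁻¹ • x) (R⁻¹ • y)
  rw [Real.dist_eq, dist_smul₀, norm_inv, Real.norm_of_nonneg hR.le] at h
  calc R ^ (-(n : ℝ)) * |φ (R⁻¹ • x) - φ (R⁻¹ • y)|
      ≤ R ^ (-(n : ℝ)) * (L * (R⁻¹ * dist x y)) := by gcongr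
    _ = _ := by ring

/-- For a mollifier at scale `R`, the gradient of the mollification is controlled by
`osc / R`, with a constant that does not depend on `R`. -/
lemma enorm_fderiv_mollify_le {n : ℕ} {φ f : Eu n → ℝ} {L : NNReal} (hL : 0 < L)
    (hφ : LipschitzWith L φ) (hsupp : ∀ y, 1 ≤ ‖y‖ → φ y = 0) {R : ℝ} (hR : 0 < R) {x : Eu n}
    (hf : IntegrableOn f (ball x (2 * R)) volume) (v : Eu n) (hv : ‖v‖ ≤ 1) :
    ‖fderiv ℝ (convWith (fun y => R ^ (-(n : ℝ)) * φ (R⁻¹ • y)) f) x v‖ₑ ≤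
      L * volume (ball (0 : Eu n) 2) * (oscOn f (ball x (2 * R)) / ENNReal.ofReal R) := by
  refine (enorm_fderiv_convWith_le (by rw [Real.toNNReal_pos]; positivity)
    (lipschitzWith_rescale hφ hR) hR (fun y hy => ?_) hf v hv).trans (le_of_eq ?_)
  · rw [hsupp, mul_zero]
    rw [norm_smul, norm_inv, Real.norm_of_nonneg hR.le, inv_mul_eq_div, one_le_div hR]
    exact hy
  · have hvol : volume (ball x (2 * R)) =
        ENNReal.ofReal (R ^ n) * volume (ball (0 : Eu n) 2) := by
      rw [mul_comm, Measure.addHaar_ball_mul_of_pos volume x hR, finrank_euclideanSpace_fin]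
    have hc : ((Real.toNNReal (L * R ^ (-(n : ℝ)) * R⁻¹) : NNReal) : ℝ≥0∞) *
        ENNReal.ofReal (R ^ n) = L * (ENNReal.ofReal R)⁻¹ := by
      rw [← ENNReal.ofReal_inv_of_pos hR, ← ENNReal.ofReal_coe_nnreal (p := L),
        ← ENNReal.ofReal_mul (by positivity)]
      change ENNReal.ofReal _ * _ = _
      rw [← ENNReal.ofReal_mul (by positivity), Real.rpow_neg hR.le, Real.rpow_natCast]
      congr 1
      field_simp
    rw [hvol, ← mul_assoc, hc, div_eq_mul_inv]
    ring

/-- The point of the lattice `δ ℤⁿ` with index `k`. -/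
noncomputable def latticePoint {n : ℕ} (δ : ℝ) (k : Fin n → ℤ) : Eu n :=
  WithLp.toLp 2 fun i => δ * k i

lemma dist_floor_latticePoint_le {n : ℕ} {δ : ℝ} (hδ : 0 < δ) (x : Eu n) :
    dist x (latticePoint δ fun i => ⌊x i / δ⌋) ≤ n * δ := by
  rw [EuclideanSpace.dist_eq]
  refine Real.sqrt_le_iff.2 ⟨by positivity, ?_⟩
  have h : ∀ i, dist (x i) (latticePoint δ (fun i => ⌊x i / δ⌋) i) ^ 2 ≤ δ ^ 2 := by
    intro i
    refine pow_le_pow_left₀ dist_nonneg ?_ 2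
    have h1 := Int.floor_le (x i / δ)
    have h2 := (Int.lt_floor_add_one (x i / δ)).le
    rw [le_div_iff₀ hδ] at h1
    rw [div_le_iff₀ hδ] at h2
    simp only [latticePoint, Real.dist_eq]
    rw [abs_le]
    constructor <;> nlinarith
  calc ∑ i, dist (x i) (latticePoint δ (fun i => ⌊x i / δ⌋) i) ^ 2
      ≤ ∑ _i : Fin n, δ ^ 2 := Finset.sum_le_sum fun i _ => h i
    _ = n * δ ^ 2 := by simp
    _ ≤ (n * δ) ^ 2 := by
        rcases Nat.eq_zero_or_pos n with rfl | hn
        · simp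
        · have : (1 : ℝ) ≤ n := by exact_mod_cast hn
          nlinarith [sq_nonneg δ, mul_nonneg (sub_nonneg.2 this) (sq_nonneg δ)]

lemma le_dist_latticePoint {n : ℕ} {δ : ℝ} (hδ : 0 < δ) {m : ℕ} {k l : Fin n → ℤ} (hkl : k ≠ l)
    (hmod : (fun i => (k i : ZMod m)) = fun i => (l i : ZMod m)) :
    m * δ ≤ dist (latticePoint δ k) (latticePoint δ l) := by
  obtain ⟨i, hi⟩ := Function.ne_iff.1 hkl
  have hdvd : (m : ℤ) ∣ k i - l i := by
    rw [← ZMod.intCast_zmod_eq_zero_iff_dvd, Int.cast_sub, sub_eq_zero]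
    exact congrFun hmod i
  have h1 : (m : ℤ) ≤ |k i - l i| :=
    Int.le_of_dvd (abs_pos.2 (sub_ne_zero.2 hi)) ((dvd_abs _ _).2 hdvd)
  have h2 : (m : ℝ) ≤ |(k i : ℝ) - l i| := by exact_mod_cast h1
  calc (m : ℝ) * δ ≤ |(k i : ℝ) - l i| * δ := by gcongr
    _ = ‖(latticePoint δ k - latticePoint δ l) i‖ := by
        simp only [latticePoint, PiLp.sub_apply, Real.norm_eq_abs]
        rw [← mul_sub, abs_mul, abs_of_pos hδ, mul_comm]
    _ ≤ _ := by rw [dist_eq_norm]; exact PiLp.norm_apply_le _ i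

lemma packSum_le_rieszVar_rpow {n : ℕ} {Ω : Set (Eu n)} {p : ℝ} (hp : 0 < p) (f w : Eu n → ℝ)
    (D : BallPack n Ω) : packSum p f w D ≤ rieszVar p f Ω w ^ p := by
  have h : packSum p f w D ^ (1 / p) ≤ rieszVar p f Ω w :=
    le_iSup (fun D : BallPack n Ω => packSum p f w D ^ (1 / p)) D
  rwa [one_div, ENNReal.rpow_inv_le_iff hp] at h

/-- A family of disjoint balls indexed by any countable infinite type contributes at most
`V_p(f; Ω, w) ^ p`. -/
lemma tsum_subtype_le_rieszVar_rpow {n : ℕ} {ι : Type*} [Countable ι] [Infinite ι]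
    {Ω : Set (Eu n)} {p : ℝ} (hp : 0 < p) (f w : Eu n → ℝ) (S : Set ι) (c : ι → Eu n) {ρ : ℝ}
    (hρ : 0 ≤ ρ) (hsub : ∀ k ∈ S, ball (c k) ρ ⊆ Ω)
    (hdisj : ∀ k ∈ S, ∀ l ∈ S, k ≠ l → Disjoint (ball (c k) ρ) (ball (c l) ρ)) :
    ∑' k, S.indicator (fun k => (oscOn f (ball (c k) ρ) / ENNReal.ofReal ρ) ^ p
      * wMeasure n w (ball (c k) ρ)) k ≤ rieszVar p f Ω w ^ p := by
  classical
  obtain ⟨_⟩ := nonempty_denumerable ι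
  let e : ℕ ≃ ι := (Denumerable.eqv ι).symm
  let r : ι → ℝ := fun k => if k ∈ S then ρ else 0
  have hr : ∀ k, k ∉ S → ball (c k) (r k) = ∅ := fun k hk => by simp [r, hk]
  have hr' : ∀ k, k ∈ S → r k = ρ := fun k hk => by simp [r, hk]
  let D : BallPack n Ω :=
    { c := fun m => c (e m)
      r := fun m => r (e m)
      r_nonneg := fun m => by
        by_cases h : e m ∈ S <;> simp [r, h, hρ]
      ball_subset := fun m => by
        by_cases h : e m ∈ S
        · rw [hr' _ h]; exact hsub _ h
        · rw [hr _ h]; exact empty_subset _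
      disj := fun a b hab => by
        change Disjoint (ball (c (e a)) (r (e a))) (ball (c (e b)) (r (e b)))
        by_cases ha : e a ∈ S
        · by_cases hb : e b ∈ S
          · rw [hr' _ ha, hr' _ hb]; exact hdisj _ ha _ hb (e.injective.ne hab)
          · rw [hr _ hb]; exact disjoint_bot_right
        · rw [hr _ ha]; exact disjoint_bot_left }
  refine le_trans (le_of_eq ?_) (packSum_le_rieszVar_rpow hp f w D)
  rw [packSum, ← e.tsum_eq]
  refine tsum_congr fun m => ?_
  by_cases h : e m ∈ S
  · simp [D, h, hr' _ h]
  · simp [D, h, hr _ h]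

/-- Splitting a lattice of balls of radius `3R` into finitely many disjoint families. -/
lemma tsum_lattice_le {n : ℕ} (hn : 0 < n) {Ω : Set (Eu n)} {p : ℝ} (hp : 0 < p)
    (f w : Eu n → ℝ) {R : ℝ} (hR : 0 < R) (S : Set (Fin n → ℤ))
    (hsub : ∀ k ∈ S, ball (latticePoint (R / n) k) (3 * R) ⊆ Ω) :
    ∑' k, S.indicator (fun k => (oscOn f (ball (latticePoint (R / n) k) (3 * R))
        / ENNReal.ofReal (3 * R)) ^ p * wMeasure n w (ball (latticePoint (R / n) k) (3 * R))) k
      ≤ ((6 * n) ^ n : ℕ) * rieszVar p f Ω w ^ p := by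
  have : Nonempty (Fin n) := ⟨⟨0, hn⟩⟩
  have : NeZero (6 * n) := ⟨by positivity⟩
  have hn' : (0 : ℝ) < n := by exact_mod_cast hn
  set a : (Fin n → ℤ) → ℝ≥0∞ := fun k => (oscOn f (ball (latticePoint (R / n) k) (3 * R))
        / ENNReal.ofReal (3 * R)) ^ p * wMeasure n w (ball (latticePoint (R / n) k) (3 * R))
  let col : (Fin n → ℤ) → (Fin n → ZMod (6 * n)) := fun k i => (k i : ZMod (6 * n))
  have hsplit : ∀ k, S.indicator a k = ∑ b, (S ∩ col ⁻¹' {b}).indicator a k := by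
    intro k
    classical
    rw [Finset.sum_eq_single (col k)]
    · by_cases hk : k ∈ S <;> simp [hk]
    · intro b _ hb
      exact indicator_of_notMem (fun h => hb h.2.symm) _
    · simp
  have hcol : ∀ b, ∑' k, (S ∩ col ⁻¹' {b}).indicator a k ≤ rieszVar p f Ω w ^ p := by
    intro b
    refine tsum_subtype_le_rieszVar_rpow hp f w _ _ (by positivity) (fun k hk => hsub k hk.1) ?_
    intro k hk l hl hkl
    refine ball_disjoint_ball (le_trans (le_of_eq ?_)
      (le_dist_latticePoint (m := 6 * n) (by positivity) hkl (hk.2.trans hl.2.symm)))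
    push_cast
    field_simp
    norm_num
  simp_rw [hsplit]
  rw [Summable.tsum_finsetSum fun _ _ => ENNReal.summable]
  refine (Finset.sum_le_sum fun b _ => hcol b).trans (le_of_eq ?_)
  simp [ZMod.card]

/-- Mollifier estimate: for any weight `w`, `f ∈ RBV^p(Ω,w)` locally
integrable, a standard mollifier `φ` supported in `B(0,1)`, every `Ω₀ ⋐ Ω`, every
`0 < R < d(Ω₀,Ωᶜ)/(6√n)` and every `j`,
`‖∂_j(φ_R ⋆ f)‖_{L^p(Ω₀,w)} ≤ C V_p(f; Ω, w)` with `C = C(n,p,φ)`. -/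
theorem statement3 (n : ℕ) (hn : 0 < n) (p : ℝ) (hp : 1 ≤ p)
    (phi : Eu n → ℝ) (hphi_smooth : ContDiff ℝ (⊤ : ℕ∞) phi)
    (hphi_cpt : HasCompactSupport phi) (hphi_supp : tsupport phi ⊆ ball 0 1)
    (hphi_nonneg : ∀ x, 0 ≤ phi x)
    (hphi_radial : ∀ x y : Eu n, ‖x‖ ≤ ‖y‖ → phi y ≤ phi x)
    (hphi_int : ∫ x, phi x = 1) :
    ∃ C : ℝ, 0 < C ∧
      ∀ (Ω : Set (Eu n)), IsOpen Ω →
      ∀ w : Eu n → ℝ, IsWeight n w →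
      ∀ f : Eu n → ℝ, LocallyIntegrableOn f Ω volume → rieszVar p f Ω w < ⊤ →
      ∀ Ω₀ : Set (Eu n), IsOpen Ω₀ → IsCompact (closure Ω₀) → closure Ω₀ ⊆ Ω →
      ∀ R : ℝ, 0 < R →
        (∀ x ∈ Ω₀, ∀ y ∈ Ωᶜ, 6 * Real.sqrt n * R < dist x y) →
      ∀ j : Fin n,
        eLpNorm
          (fun x => fderiv ℝ
            (convWith (fun y => R ^ (-(n : ℝ)) * phi (R⁻¹ • y)) f) x
            (EuclideanSpace.single j 1))
          (ENNReal.ofReal p) ((wMeasure n w).restrict Ω₀)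
          ≤ ENNReal.ofReal C * rieszVar p f Ω w := by
  obtain ⟨L₀, hL₀⟩ := hphi_smooth.lipschitzWith_of_hasCompactSupport (𝕂 := ℝ) hphi_cpt (by simp)
  have hL : LipschitzWith (L₀ + 1) phi := hL₀.weaken (by simp)
  have hsupp : ∀ y, 1 ≤ ‖y‖ → phi y = 0 := fun y hy => by
    by_contra h
    have := hphi_supp (subset_tsupport _ h)
    rw [mem_ball_zero_iff] at this
    linarith
  have hp0 : 0 < p := by linarith
  set K : ℝ≥0∞ := 3 * (((L₀ + 1 : NNReal) : ℝ≥0∞) * volume (ball (0 : Eu n) 2)) with hK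
  set N : ℝ≥0∞ := (((6 * n) ^ n : ℕ) : ℝ≥0∞) with hN
  have hK0 : K ≠ 0 :=
    mul_ne_zero (by norm_num) (mul_ne_zero (by simp) (measure_ball_pos _ _ (by norm_num)).ne')
  have hKt : K ≠ ⊤ :=
    ENNReal.mul_ne_top (by norm_num) (ENNReal.mul_ne_top (by simp) measure_ball_lt_top.ne)
  have hN0 : N ≠ 0 := by
    rw [hN, Nat.cast_ne_zero]
    positivity
  have hNt : N ≠ ⊤ := ENNReal.natCast_ne_top _
  have hKN0 : K * N ^ (1 / p) ≠ 0 := mul_ne_zero hK0 (by simp [hN0, hNt])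
  have hKNt : K * N ^ (1 / p) ≠ ⊤ :=
    ENNReal.mul_ne_top hKt (ENNReal.rpow_ne_top_of_nonneg (by positivity) hNt)
  refine ⟨(K * N ^ (1 / p)).toReal, ENNReal.toReal_pos hKN0 hKNt, ?_⟩
  intro Ω _ w _ f hf _ Ω₀ hΩ₀ _ _ R hR hdist j
  rw [ENNReal.ofReal_toReal hKNt]
  have hsqrt : 1 ≤ Real.sqrt n := by
    rw [Real.one_le_sqrt]
    exact_mod_cast hn
  have hn' : (0 : ℝ) < n := by exact_mod_cast hn
  have hin : ∀ x ∈ Ω₀, ∀ y, dist x y < 6 * R → y ∈ Ω := by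
    intro x hx y hy
    by_contra h
    have := hdist x hx y h
    nlinarith
  set z : (Fin n → ℤ) → Eu n := latticePoint (R / n)
  set S : Set (Fin n → ℤ) := {k | (Ω₀ ∩ closedBall (z k) R).Nonempty}
  set g : Eu n → ℝ := fun x => fderiv ℝ
    (convWith (fun y => R ^ (-(n : ℝ)) * phi (R⁻¹ • y)) f) x (EuclideanSpace.single j 1)
  set a : (Fin n → ℤ) → ℝ≥0∞ := fun k => (oscOn f (ball (z k) (3 * R))
        / ENNReal.ofReal (3 * R)) ^ p * wMeasure n w (ball (z k) (3 * R)) with ha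
  have hsubΩ : ∀ k ∈ S, ball (z k) (3 * R) ⊆ Ω := by
    rintro k ⟨x, hx, hxk⟩ y hy
    rw [mem_closedBall] at hxk
    rw [mem_ball'] at hy
    exact hin x hx y (by linarith [dist_triangle x (z k) y])
  have hpt : ∀ k, ∀ x ∈ Ω₀ ∩ closedBall (z k) R,
      ‖g x‖ₑ ≤ K * (oscOn f (ball (z k) (3 * R)) / ENNReal.ofReal (3 * R)) := by
    rintro k x ⟨hx, hxk⟩
    rw [mem_closedBall] at hxk
    have hfi : IntegrableOn f (ball x (2 * R)) volume := by
      refine (hf.integrableOn_compact_subset ?_ (isCompact_closedBall x (2 * R))).mono_set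
        ball_subset_closedBall
      intro y hy
      rw [mem_closedBall'] at hy
      exact hin x hx y (by linarith)
    refine (enorm_fderiv_mollify_le (by positivity) hL hsupp hR hfi _ (by simp)).trans ?_
    have h3 : oscOn f (ball x (2 * R)) / ENNReal.ofReal R
        ≤ 3 * (oscOn f (ball (z k) (3 * R)) / ENNReal.ofReal (3 * R)) := by
      rw [ENNReal.ofReal_mul (by norm_num), ENNReal.ofReal_ofNat, ← mul_div_assoc,
        ENNReal.mul_div_mul_left _ _ (by norm_num) (by norm_num)]
      exact ENNReal.div_le_div_right (oscOn_mono f (ball_subset_ball' (by linarith))) _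
    calc _ ≤ ((L₀ + 1 : NNReal) : ℝ≥0∞) * volume (ball (0 : Eu n) 2) *
          (3 * (oscOn f (ball (z k) (3 * R)) / ENNReal.ofReal (3 * R))) := by gcongr
      _ = _ := by rw [hK]; ring
  have hpiece : ∀ k, ∫⁻ x in Ω₀ ∩ closedBall (z k) R, ‖g x‖ₑ ^ p ∂(wMeasure n w)
      ≤ K ^ p * S.indicator a k := by
    intro k
    by_cases hk : k ∈ S
    · rw [indicator_of_mem hk]
      refine (setLIntegral_mono' (hΩ₀.measurableSet.inter measurableSet_closedBall)
        fun x hx => ENNReal.rpow_le_rpow (hpt k x hx) hp0.le).trans ?_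
      rw [setLIntegral_const, ENNReal.mul_rpow_of_nonneg _ _ hp0.le, mul_assoc]
      have : Ω₀ ∩ closedBall (z k) R ⊆ ball (z k) (3 * R) :=
        inter_subset_right.trans (closedBall_subset_ball (by linarith))
      simp only [ha]
      gcongr
    · have he : Ω₀ ∩ closedBall (z k) R = ∅ := not_nonempty_iff_eq_empty.1 hk
      simp [he]
  have hcover : Ω₀ ⊆ ⋃ k, Ω₀ ∩ closedBall (z k) R := fun x hx =>
    mem_iUnion.2 ⟨fun i => ⌊x i / (R / n)⌋, hx, by
      have := dist_floor_latticePoint_le (δ := R / n) (by positivity) x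
      rwa [mul_div_cancel₀ _ hn'.ne'] at this⟩
  have hmain : ∫⁻ x in Ω₀, ‖g x‖ₑ ^ p ∂(wMeasure n w) ≤ K ^ p * (N * rieszVar p f Ω w ^ p) :=
    calc ∫⁻ x in Ω₀, ‖g x‖ₑ ^ p ∂(wMeasure n w)
        ≤ ∫⁻ x in ⋃ k, Ω₀ ∩ closedBall (z k) R, ‖g x‖ₑ ^ p ∂(wMeasure n w) :=
          lintegral_mono_set hcover
      _ ≤ ∑' k, ∫⁻ x in Ω₀ ∩ closedBall (z k) R, ‖g x‖ₑ ^ p ∂(wMeasure n w) :=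
          lintegral_iUnion_le _ _
      _ ≤ ∑' k, K ^ p * S.indicator a k := ENNReal.tsum_le_tsum hpiece
      _ = K ^ p * ∑' k, S.indicator a k := ENNReal.tsum_mul_left
      _ ≤ _ := by
          gcongr
          exact tsum_lattice_le hn hp0 f w hR S hsubΩ
  rw [eLpNorm_eq_lintegral_rpow_enorm_toReal (by simpa using hp0) ENNReal.ofReal_ne_top,
    ENNReal.toReal_ofReal hp0.le]
  clear_value K
  refine (ENNReal.rpow_le_rpow hmain (by positivity)).trans (le_of_eq ?_)
  rw [ENNReal.mul_rpow_of_nonneg _ _ (by positivity), ENNReal.mul_rpow_of_nonneg _ _ (by positivity),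
    ← ENNReal.rpow_mul, ← ENNReal.rpow_mul, mul_one_div_cancel hp0.ne', ENNReal.rpow_one,
    ENNReal.rpow_one, mul_assoc]
end

section
/- Let 1 ≤ p < ∞ and w ∈ A_p, and let f ∈ RBV^p(ℝⁿ, w). Then for all t > 0, w({x ∈ ℝⁿ : L_f(x) > t}) ≤ C (V_p(f; ℝⁿ, w)/t)^p, where L_f(x) = limsup_{y→x} |f(x) − f(y)|/|x − y| is the local Lipschitz constant of f at x, and C depends only on p, n, and [w]_{A_p}. -/
open MeasureTheory Metric Set ENNReal Filter

/-- A countable family of pairwise disjoint balls is controlled by the Riesz variation. -/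
theorem tsum_oscOn_div_rpow_mul_le_rieszVar_rpow {n : ℕ} {p : ℝ} (hp : 0 < p) (f w : Eu n → ℝ)
    {ι : Type*} [Countable ι] (c : ι → Eu n) (r : ι → ℝ) (hr : ∀ i, 0 ≤ r i)
    (hd : Pairwise fun i j => Disjoint (ball (c i) (r i)) (ball (c j) (r j))) :
    ∑' i, (oscOn f (ball (c i) (r i)) / ENNReal.ofReal (r i)) ^ p * wMeasure n w (ball (c i) (r i))
      ≤ rieszVar p f Set.univ w ^ p := by
  obtain ⟨e, he⟩ := Countable.exists_injective_nat ι
  have hr_apply (i : ι) : Function.extend e r (0 : ℕ → ℝ) (e i) = r i := he.extend_apply r _ i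
  have hc_apply (i : ι) : Function.extend e c (0 : ℕ → Eu n) (e i) = c i := he.extend_apply c _ i
  have hr_zero (k : ℕ) (hk : ¬∃ i, e i = k) : Function.extend e r (0 : ℕ → ℝ) k = 0 :=
    Function.extend_apply' r _ k hk
  let D : BallPack n Set.univ :=
    { c := Function.extend e c (0 : ℕ → Eu n)
      r := Function.extend e r (0 : ℕ → ℝ)
      r_nonneg := fun k => by
        by_cases hk : ∃ i, e i = k
        · obtain ⟨i, rfl⟩ := hk
          rw [hr_apply]
          exact hr i
        · exact (hr_zero k hk).ge
      ball_subset := fun _ => subset_univ _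
      disj := fun k l hkl => by
        by_cases hk : ∃ i, e i = k
        · by_cases hl : ∃ i, e i = l
          · obtain ⟨i, rfl⟩ := hk
            obtain ⟨j, rfl⟩ := hl
            simp only [hr_apply, hc_apply]
            exact hd fun h => hkl (congrArg e h)
          · simp [hr_zero l hl]
        · simp [hr_zero k hk] }
  calc _ ≤ packSum p f w D := by
        refine le_trans (le_of_eq ?_) (ENNReal.tsum_comp_le_tsum_of_injective he _)
        refine tsum_congr fun i => ?_
        simp only [D, hr_apply, hc_apply]
    _ = (packSum p f w D ^ (1 / p)) ^ p := by
        rw [← ENNReal.rpow_mul, one_div_mul_cancel hp.ne', ENNReal.rpow_one]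
    _ ≤ rieszVar p f Set.univ w ^ p :=
        ENNReal.rpow_le_rpow (le_iSup (fun D : BallPack n Set.univ => packSum p f w D ^ (1 / p)) D)
          hp.le

/-- A large local Lipschitz constant at `x` forces a large oscillation on a small ball
centred at `x`. -/
theorem exists_ball_le_oscOn_div_of_lt_localLip {n : ℕ} {f : Eu n → ℝ} {x : Eu n} {t : ℝ}
    (h : ENNReal.ofReal t < localLip f x) :
    ∃ r : ℝ, 0 < r ∧ r ≤ 1 ∧
      ENNReal.ofReal (t / 2) ≤ oscOn f (ball x r) / ENNReal.ofReal r := by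
  have hfreq := frequently_lt_of_lt_limsup (by isBoundedDefault) h
  have hev : ∀ᶠ y in nhdsWithin x {x}ᶜ, y ∈ ball x (1 / 2) ∧ y ≠ x :=
    (eventually_nhdsWithin_of_eventually_nhds (ball_mem_nhds x (by norm_num))).and
      self_mem_nhdsWithin
  obtain ⟨y, hty, hy, hyx⟩ := (hfreq.and_eventually hev).exists
  have hd : 0 < dist x y := dist_pos.2 hyx.symm
  have hd' : dist x y < 1 / 2 := by rwa [mem_ball'] at hy
  refine ⟨2 * dist x y, by positivity, by linarith, ?_⟩
  have hlt : t < |f x - f y| / dist x y := (ENNReal.ofReal_lt_ofReal_iff'.1 hty).1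
  rw [lt_div_iff₀ hd] at hlt
  rw [ENNReal.le_div_iff_mul_le (Or.inl (by simpa using hyx.symm)) (Or.inl ENNReal.ofReal_ne_top),
    ← ENNReal.ofReal_mul' (by positivity)]
  calc ENNReal.ofReal (t / 2 * (2 * dist x y)) ≤ ENNReal.ofReal |f x - f y| :=
        ENNReal.ofReal_le_ofReal (by linarith)
    _ ≤ oscOn f (ball x (2 * dist x y)) :=
        le_iSup₂_of_le x (mem_ball_self (by positivity)) <|
          le_iSup₂_of_le (f := fun y _ => ENNReal.ofReal |f x - f y|) y
            (by rw [mem_ball']; linarith) le_rfl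

/-- Weak type estimate for the local Lipschitz constant: if `w ∈ A_p`,
`1 ≤ p < ∞` and `f ∈ RBV^p(ℝⁿ,w)`, then for all `t > 0`,
`w({L_f > t}) ≤ C (V_p(f; ℝⁿ, w)/t)^p`, with `C = C(n, p, [w]_{A_p})`. -/
theorem statement5 (n : ℕ) (hn : 0 < n) (p Cw : ℝ) (hp : 1 ≤ p) :
    ∃ C : ℝ, 0 < C ∧
      ∀ w : Eu n → ℝ, IsWeight n w → IsMuckenhoupt n p w Cw →
      ∀ f : Eu n → ℝ, rieszVar p f Set.univ w < ⊤ →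
      ∀ t : ℝ, 0 < t →
        wMeasure n w {x | ENNReal.ofReal t < localLip f x} ≤
          ENNReal.ofReal C * (rieszVar p f Set.univ w / ENNReal.ofReal t) ^ p := by
  obtain ⟨N, τ, hτ, hN⟩ := HasBesicovitchCovering.no_satelliteConfig (α := Eu n)
  have hp0 : 0 < p := by linarith
  refine ⟨(N + 1) * 2 ^ p, by positivity, fun w _ _ f _ t ht => ?_⟩
  set A := {x | ENNReal.ofReal t < localLip f x}
  set V := rieszVar p f Set.univ w
  set μ := wMeasure n w
  choose! r hr hr1 hosc using fun x (hx : x ∈ A) => exists_ball_le_oscOn_div_of_lt_localLip hx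
  let q : Besicovitch.BallPackage A (Eu n) :=
    { c := Subtype.val
      r := fun x => r x
      rpos := fun x => hr x x.2
      r_bound := 1
      r_le := fun x => hr1 x x.2 }
  obtain ⟨s, hs, hcover⟩ := Besicovitch.exist_disjoint_covering_families hτ hN q
  have hdisj (i : Fin N) : (s i).PairwiseDisjoint fun x => ball (x : Eu n) (r x) :=
    (hs i).mono fun _ => ball_subset_closedBall
  have hcount (i : Fin N) : (s i).Countable :=
    (hdisj i).countable_of_isOpen (fun _ _ => isOpen_ball)
      fun x _ => nonempty_ball.2 (hr x x.2)
  have hfamily (i : Fin N) :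
      ENNReal.ofReal (t / 2) ^ p * μ (⋃ x ∈ s i, ball (x : Eu n) (r x)) ≤ V ^ p := by
    have := (hcount i).to_subtype
    calc _ ≤ ENNReal.ofReal (t / 2) ^ p * ∑' x : s i, μ (ball (x : Eu n) (r x)) := by
          gcongr
          exact measure_biUnion_le μ (hcount i) _
      _ = ∑' x : s i, ENNReal.ofReal (t / 2) ^ p * μ (ball (x : Eu n) (r x)) :=
          ENNReal.tsum_mul_left.symm
      _ ≤ ∑' x : s i, (oscOn f (ball (x : Eu n) (r x)) / ENNReal.ofReal (r x)) ^ p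
            * μ (ball (x : Eu n) (r x)) := by
          gcongr with x
          exact hosc x x.1.2
      _ ≤ V ^ p :=
          tsum_oscOn_div_rpow_mul_le_rieszVar_rpow hp0 f w (fun x : s i => (x : Eu n))
            (fun x => r x) (fun x => (hr x x.1.2).le)
            fun x y hxy => hdisj i x.2 y.2 (Subtype.coe_ne_coe.2 hxy)
  have hA : ENNReal.ofReal (t / 2) ^ p * μ A ≤ N * V ^ p := by
    calc ENNReal.ofReal (t / 2) ^ p * μ A
        ≤ ENNReal.ofReal (t / 2) ^ p * ∑ i, μ (⋃ x ∈ s i, ball (x : Eu n) (r x)) := by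
          gcongr
          refine (measure_mono ?_).trans (measure_iUnion_fintype_le μ _)
          simpa [q] using hcover
      _ = ∑ i, ENNReal.ofReal (t / 2) ^ p * μ (⋃ x ∈ s i, ball (x : Eu n) (r x)) :=
          Finset.mul_sum _ _ _
      _ ≤ ∑ _i : Fin N, V ^ p := Finset.sum_le_sum fun i _ => hfamily i
      _ = N * V ^ p := by simp
  have ht2 : ENNReal.ofReal (t / 2) = ENNReal.ofReal t / 2 := by
    rw [ENNReal.ofReal_div_of_pos two_pos, ENNReal.ofReal_ofNat]
  have hpos : ENNReal.ofReal (t / 2) ≠ 0 := by simpa using ht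
  have hconst : ENNReal.ofReal ((N + 1) * 2 ^ p) = (N + 1) * 2 ^ p := by
    rw [ENNReal.ofReal_mul (by positivity), ← ENNReal.ofReal_rpow_of_pos two_pos,
      ENNReal.ofReal_add (by positivity) zero_le_one]
    simp
  have hdiv : V / ENNReal.ofReal (t / 2) = 2 * (V / ENNReal.ofReal t) := by
    rw [ht2, div_eq_mul_inv, ENNReal.inv_div (Or.inl (by simp)) (Or.inl (by simp)),
      div_eq_mul_inv, div_eq_mul_inv, mul_left_comm]
  calc μ A ≤ N * V ^ p / ENNReal.ofReal (t / 2) ^ p := by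
        rw [ENNReal.le_div_iff_mul_le (Or.inl (ENNReal.rpow_pos hpos.bot_lt ofReal_ne_top).ne')
          (Or.inl (ENNReal.rpow_ne_top_of_nonneg hp0.le ofReal_ne_top)), mul_comm]
        exact hA
    _ = N * (2 ^ p * (V / ENNReal.ofReal t) ^ p) := by
        rw [mul_div_assoc, ← ENNReal.div_rpow_of_nonneg _ _ hp0.le, hdiv,
          ENNReal.mul_rpow_of_nonneg _ _ hp0.le]
    _ ≤ (N + 1) * (2 ^ p * (V / ENNReal.ofReal t) ^ p) := by
        gcongr
        exact le_self_add
    _ = _ := by rw [hconst, mul_assoc]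
end

section
/- Let 1 ≤ p < ∞ and w ∈ A_p. If f : ℝⁿ → ℝ is measurable and f ∈ RBV^p(ℝⁿ, w), then f is (totally) differentiable at Lebesgue-almost every point of ℝⁿ. -/
open MeasureTheory Metric Set ENNReal Filter

open scoped NNReal Topology

/-- The largest McShane extension: a function which is `K`-Lipschitz on a nonempty set `A` has a
`K`-Lipschitz extension whose value at `z` is at least every lower bound of the cones
`f x + K * dist z x` with `x ∈ A`. -/
theorem LipschitzOnWith.exists_lipschitzWith_ge_of_le_cones {α : Type*} [PseudoMetricSpace α]
    {f : α → ℝ} {A : Set α} {K : ℝ≥0} (hA : A.Nonempty) (hf : LipschitzOnWith K f A) :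
    ∃ v : α → ℝ, LipschitzWith K v ∧ EqOn f v A ∧
      ∀ z c, (∀ x ∈ A, c ≤ f x + K * dist z x) → c ≤ v z := by
  have : Nonempty A := hA.to_subtype
  let v : α → ℝ := fun z => ⨅ x : A, (f x + K * dist z (x : α))
  have bdd : ∀ z : α, BddBelow (range fun x : A => f x + K * dist z (x : α)) := by
    intro z
    obtain ⟨a, ha⟩ := hA
    refine ⟨f a - K * dist z a, ?_⟩
    rintro _ ⟨x, rfl⟩
    have h1 := hf.le_add_mul ha x.2
    have h2 : (K : ℝ) * dist a x ≤ K * (dist z a + dist z x) := by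
      gcongr
      exact dist_triangle_left _ _ _
    dsimp only
    linarith
  refine ⟨v, LipschitzWith.of_le_add_mul K fun y z => ?_, fun x hx => ?_,
    fun z c hc => le_ciInf fun x => hc x x.2⟩
  · rw [← sub_le_iff_le_add]
    refine le_ciInf fun x => ?_
    have h1 : v y ≤ f x + K * dist y x := ciInf_le (bdd y) x
    have h2 : (K : ℝ) * dist y x ≤ K * (dist y z + dist z x) := by
      gcongr
      exact dist_triangle _ _ _
    linarith
  · refine le_antisymm (le_ciInf fun y => hf.le_add_mul hx y.2) ?_
    simpa using ciInf_le (bdd x) ⟨x, hx⟩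

/-- A function squeezed near `x` between two functions which are differentiable at `x` and agree
there is differentiable at `x`. -/
theorem DifferentiableAt.of_squeeze {E : Type*} [NormedAddCommGroup E] [NormedSpace ℝ E]
    {u f v : E → ℝ} {x : E} (hu : DifferentiableAt ℝ u x) (hv : DifferentiableAt ℝ v x)
    (huf : ∀ᶠ y in 𝓝 x, u y ≤ f y) (hfv : ∀ᶠ y in 𝓝 x, f y ≤ v y)
    (hux : u x = f x) (hvx : v x = f x) : DifferentiableAt ℝ f x := by
  have hmin : IsLocalMin (fun y => v y - u y) x := by
    filter_upwards [huf, hfv] with y h1 h2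
    linarith
  have hd : HasFDerivAt (fun y => v y - u y) (0 : E →L[ℝ] ℝ) x := by
    have h := (hv.sub hu).hasFDerivAt
    rwa [show v - u = fun y => v y - u y from rfl, hmin.fderiv_eq_zero] at h
  have hg : HasFDerivAt (fun y => f y - u y) (0 : E →L[ℝ] ℝ) x := by
    rw [hasFDerivAt_iff_isLittleO] at hd ⊢
    refine Asymptotics.IsBigO.trans_isLittleO (Asymptotics.IsBigO.of_bound 1 ?_) hd
    filter_upwards [huf, hfv] with y h1 h2
    simp only [hux, hvx, sub_self, sub_zero, zero_apply, one_mul,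
      Real.norm_eq_abs]
    rw [abs_of_nonneg (by linarith), abs_of_nonneg (by linarith)]
    linarith
  have h := hg.differentiableAt.add hu
  rwa [show (fun y => f y - u y) + u = f from funext fun y => sub_add_cancel _ _] at h

/-- **Stepanov's theorem** for real functions on a finite-dimensional space: a function is
differentiable at almost every point at which it is pointwise Lipschitz. -/
theorem ae_differentiableAt_of_pointwise_lipschitz {E : Type*} [NormedAddCommGroup E]
    [NormedSpace ℝ E] [FiniteDimensional ℝ E] [MeasurableSpace E] [BorelSpace E]
    (μ : Measure E) [μ.IsAddHaarMeasure] (f : E → ℝ) :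
    ∀ᵐ x ∂μ, (∃ K : ℝ, ∀ᶠ y in 𝓝 x, |f y - f x| ≤ K * dist y x) → DifferentiableAt ℝ f x := by
  have key : ∀ (U : Set E), IsOpen U → ∀ k : ℕ, ∀ᵐ x ∂μ,
      (x ∈ U ∧ ∀ y ∈ U, |f y - f x| ≤ k * dist y x) → DifferentiableAt ℝ f x := by
    intro U hU k
    set A := {x | x ∈ U ∧ ∀ y ∈ U, |f y - f x| ≤ k * dist y x} with hAdef
    rcases A.eq_empty_or_nonempty with hA | hA
    · refine Eventually.of_forall fun x hx => ?_
      have : x ∈ A := hx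
      simp [hA] at this
    have hf : LipschitzOnWith (k : ℝ≥0) f A := LipschitzOnWith.of_dist_le_mul
      fun x hx y hy => by simpa [Real.dist_eq] using hy.2 x hx.1
    obtain ⟨v, hv, hfv, hvc⟩ := hf.exists_lipschitzWith_ge_of_le_cones hA
    obtain ⟨u, hu, hfu, huc⟩ := hf.neg.exists_lipschitzWith_ge_of_le_cones hA
    filter_upwards [hv.ae_differentiableAt (μ := μ), hu.ae_differentiableAt (μ := μ)]
      with x hvx hux hx
    refine DifferentiableAt.of_squeeze hux.neg hvx ?_ ?_ ?_ (hfv hx).symm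
    · filter_upwards [hU.mem_nhds hx.1] with y hy
      have := huc y (-f y) fun a ha => by
        have := abs_le.1 (ha.2 y hy)
        simp only [Pi.neg_apply, NNReal.coe_natCast]
        linarith
      simp only [Pi.neg_apply]
      linarith
    · filter_upwards [hU.mem_nhds hx.1] with y hy
      refine hvc y (f y) fun a ha => ?_
      have := abs_le.1 (ha.2 y hy)
      simp only [NNReal.coe_natCast]
      linarith
    · have := hfu hx
      simp only [Pi.neg_apply] at this ⊢
      linarith
  have hall : ∀ᵐ x ∂μ, ∀ U ∈ TopologicalSpace.countableBasis E, ∀ k : ℕ,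
      (x ∈ U ∧ ∀ y ∈ U, |f y - f x| ≤ k * dist y x) → DifferentiableAt ℝ f x :=
    (ae_ball_iff (TopologicalSpace.countable_countableBasis E)).2 fun U hU =>
      ae_all_iff.2 (key U (TopologicalSpace.isOpen_of_mem_countableBasis hU))
  filter_upwards [hall] with x hx
  rintro ⟨K, hK⟩
  obtain ⟨U, hU, hxU, hUs⟩ :=
    (TopologicalSpace.isBasis_countableBasis E).mem_nhds_iff.1 hK
  refine hx U hU ⌈K⌉₊ ⟨hxU, fun y hy => (hUs hy).trans ?_⟩
  gcongr
  exact Nat.le_ceil K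

/-- An `A_p` weight is positive almost everywhere. -/
theorem MemAp.ae_ne_zero {n : ℕ} {p : ℝ} (hp : 1 ≤ p) {w : Eu n → ℝ}
    (hw : AEMeasurable w volume) (hA : MemAp n p w) :
    ∀ᵐ x : Eu n ∂volume, ENNReal.ofReal (w x) ≠ 0 := by
  obtain ⟨C, hpos, h1, h2⟩ := hA
  have hball : ∀ r : ℕ, ∀ᵐ x : Eu n ∂volume.restrict (ball 0 ((r : ℝ) + 1)),
      ENNReal.ofReal (w x) ≠ 0 := by
    intro r
    have hr : (0 : ℝ) < r + 1 := by positivity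
    have hlt : volume (ball (0 : Eu n) ((r : ℝ) + 1)) ≠ ⊤ := measure_ball_lt_top.ne
    have hav : (⨍⁻ y in ball (0 : Eu n) ((r : ℝ) + 1), ENNReal.ofReal (w y) ∂volume) ≠ 0 := by
      rw [setLAverage_eq]
      exact (ENNReal.div_pos (hpos _ _ hr).ne' hlt).ne'
    rcases hp.eq_or_lt with rfl | hp
    · have h := h1 rfl 0 _ hr
      have hsup : essSup (fun y => (ENNReal.ofReal (w y))⁻¹)
          (volume.restrict (ball (0 : Eu n) ((r : ℝ) + 1))) < ⊤ := by
        refine lt_top_iff_ne_top.2 fun htop => ?_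
        rw [htop, ENNReal.top_mul hav] at h
        exact ENNReal.ofReal_ne_top (top_le_iff.1 h)
      filter_upwards [ENNReal.ae_le_essSup (μ := volume.restrict (ball (0 : Eu n) ((r : ℝ) + 1)))
        fun y => (ENNReal.ofReal (w y))⁻¹] with x hx h0
      rw [h0, ENNReal.inv_zero] at hx
      exact hsup.not_ge hx
    · have h := h2 hp 0 _ hr
      have hp1 : 0 < p - 1 := by linarith
      have hfin : (∫⁻ y in ball (0 : Eu n) ((r : ℝ) + 1),
          ENNReal.ofReal (w y) ^ (1 / (1 - p)) ∂volume) ≠ ⊤ := by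
        intro htop
        have hav' : (⨍⁻ y in ball (0 : Eu n) ((r : ℝ) + 1),
            ENNReal.ofReal (w y) ^ (1 / (1 - p)) ∂volume) = ⊤ := by
          rw [setLAverage_eq, htop, ENNReal.top_div_of_ne_top hlt]
        rw [hav', ENNReal.top_rpow_of_pos hp1, ENNReal.mul_top hav] at h
        exact ENNReal.ofReal_ne_top (top_le_iff.1 h)
      have hm : AEMeasurable (fun y => ENNReal.ofReal (w y) ^ (1 / (1 - p)))
          (volume.restrict (ball (0 : Eu n) ((r : ℝ) + 1))) :=
        hw.restrict.ennreal_ofReal.pow_const _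
      filter_upwards [ae_lt_top' hm hfin] with x hx h0
      rw [h0, ENNReal.zero_rpow_of_neg (one_div_neg.2 (by linarith))] at hx
      exact hx.ne rfl
  have hU : (⋃ r : ℕ, ball (0 : Eu n) ((r : ℝ) + 1)) = univ := by
    refine eq_univ_of_forall fun x => mem_iUnion.2 ?_
    obtain ⟨r, hr⟩ := exists_nat_gt (dist x 0)
    exact ⟨r, by rw [mem_ball]; linarith⟩
  rw [← Measure.restrict_univ (μ := (volume : Measure (Eu n))), ← hU, ae_restrict_iUnion_iff]
  exact hball

/-- The Riesz sum over a countable disjoint family of balls indexed by their centres is at most the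
`p`-th power of the Riesz variation. -/
theorem tsum_le_rieszVar_rpow {n : ℕ} {p : ℝ} (hp : 0 < p) (f w : Eu n → ℝ) {t : Set (Eu n)}
    (ht : t.Countable) {r : Eu n → ℝ} (hr : ∀ x ∈ t, 0 ≤ r x)
    (hd : t.PairwiseDisjoint fun x => ball x (r x)) :
    ∑' x : t, (oscOn f (ball (x : Eu n) (r x)) / ENNReal.ofReal (r x)) ^ p
      * wMeasure n w (ball (x : Eu n) (r x)) ≤ rieszVar p f univ w ^ p := by
  have : Encodable t := ht.toEncodable
  let D : BallPack n univ :=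
    { c := fun k => (Encodable.decode₂ t k).elim 0 fun x => (x : Eu n)
      r := fun k => (Encodable.decode₂ t k).elim 0 fun x => r x
      r_nonneg := fun k => by
        cases h : Encodable.decode₂ t k with
        | none => simp
        | some x => simpa using hr x x.2
      ball_subset := fun _ => subset_univ _
      disj := fun i j hij => by
        cases hi : Encodable.decode₂ t i with
        | none => simp [hi]
        | some x =>
          cases hj : Encodable.decode₂ t j with
          | none => simp
          | some y =>
            simp only [hi, Option.elim]
            refine hd x.2 y.2 fun hxy => hij ?_
            rw [← Encodable.mem_decode₂.1 hi, ← Encodable.mem_decode₂.1 hj, Subtype.ext hxy] }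
  have hle : packSum p f w D ≤ rieszVar p f univ w ^ p := by
    rw [← ENNReal.rpow_inv_le_iff hp, ← one_div]
    exact le_iSup (fun D : BallPack n univ => packSum p f w D ^ (1 / p)) D
  refine le_trans ?_ hle
  have := ENNReal.tsum_comp_le_tsum_of_injective (Encodable.encode_injective (α := t))
    fun k => (oscOn f (ball (D.c k) (D.r k)) / ENNReal.ofReal (D.r k)) ^ p
      * wMeasure n w (ball (D.c k) (D.r k))
  simpa only [D, Encodable.encodek₂, Option.elim, packSum] using this

/-- A function of finite Riesz variation is pointwise Lipschitz almost everywhere with respect to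
the weighted measure. -/
theorem wMeasure_not_pointwise_lipschitz_eq_zero {n : ℕ} {p : ℝ} (hp : 1 ≤ p) {f w : Eu n → ℝ}
    (hf : rieszVar p f univ w < ⊤) :
    wMeasure n w {x | ¬ ∃ K : ℝ, ∀ᶠ y in 𝓝 x, |f y - f x| ≤ K * dist y x} = 0 := by
  have hp0 : 0 < p := by linarith
  set E := {x | ¬ ∃ K : ℝ, ∀ᶠ y in 𝓝 x, |f y - f x| ≤ K * dist y x}
  have : SFinite (wMeasure n w) := by unfold wMeasure; infer_instance
  have hac : wMeasure n w ≪ volume := withDensity_absolutelyContinuous _ _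
  have hbound : ∀ M : ℕ, 0 < M → M * wMeasure n w E ≤ rieszVar p f univ w ^ p := by
    intro M hM
    let G : Eu n → Set ℝ := fun x =>
      {r | (M : ℝ≥0∞) ≤ oscOn f (ball x r) / ENNReal.ofReal r}
    have hG : ∀ x ∈ E, ∀ δ > 0, (G x ∩ Ioo 0 δ).Nonempty := by
      intro x hx δ hδ
      have hx' : ∃ᶠ y in 𝓝 x, ¬ |f y - f x| ≤ (2 * M : ℝ) * dist y x := by
        intro h
        exact hx ⟨_, by simpa using h⟩
      obtain ⟨y, hy, hyδ⟩ := (hx'.and_eventually (ball_mem_nhds x (half_pos hδ))).exists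
      rw [not_le] at hy
      have hyx : 0 < dist y x := by
        refine dist_pos.2 fun h => ?_
        simp [h] at hy
      refine ⟨2 * dist y x, ?_, by positivity, by linarith⟩
      have hr : 0 < 2 * dist y x := by positivity
      have hosc : ENNReal.ofReal |f y - f x| ≤ oscOn f (ball x (2 * dist y x)) :=
        le_iSup₂_of_le y (by rw [mem_ball]; linarith)
          (le_iSup₂_of_le x (mem_ball_self hr) le_rfl)
      change (M : ℝ≥0∞) ≤ _
      rw [ENNReal.le_div_iff_mul_le (.inl (by simpa using hyx.ne')) (.inl ENNReal.ofReal_ne_top),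
        ← ENNReal.ofReal_natCast, ← ENNReal.ofReal_mul (by positivity)]
      refine le_trans (ENNReal.ofReal_le_ofReal ?_) hosc
      linarith
    obtain ⟨t, r, htc, -, htr, hcov, hdisj⟩ := Besicovitch.exists_disjoint_closedBall_covering_ae
      (wMeasure n w) G E hG (fun _ => 1) fun _ _ => one_pos
    have hcl : ∀ x ∈ t, wMeasure n w (closedBall x (r x)) ≤ wMeasure n w (ball x (r x)) := by
      intro x hx
      rw [← ball_union_sphere]
      refine (measure_union_le _ _).trans ?_
      rw [hac (Measure.addHaar_sphere_of_ne_zero volume x (htr x hx).2.1.ne'), add_zero]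
    have hE : wMeasure n w E ≤ ∑' x : t, wMeasure n w (ball (x : Eu n) (r x)) :=
      calc wMeasure n w E
          ≤ wMeasure n w (⋃ x ∈ t, closedBall x (r x)) := by
            refine (measure_le_inter_add_sdiff _ E (⋃ x ∈ t, closedBall x (r x))).trans ?_
            rw [hcov, add_zero]
            exact measure_mono inter_subset_right
        _ ≤ ∑' x : t, wMeasure n w (closedBall (x : Eu n) (r x)) := measure_biUnion_le _ htc _
        _ ≤ _ := ENNReal.tsum_le_tsum fun x => hcl x x.2
    refine le_trans ?_ (tsum_le_rieszVar_rpow hp0 f w htc (fun x hx => (htr x hx).2.1.le)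
      (hdisj.mono fun x => ball_subset_closedBall))
    refine (mul_le_mul_right hE _).trans ?_
    rw [← ENNReal.tsum_mul_left]
    refine ENNReal.tsum_le_tsum fun x => ?_
    gcongr
    have hMG : (M : ℝ≥0∞) ≤ oscOn f (ball (x : Eu n) (r x)) / ENNReal.ofReal (r x) :=
      (htr x x.2).1
    have h1 : (1 : ℝ≥0∞) ≤ M := by exact_mod_cast hM
    exact (ENNReal.le_rpow_self_of_one_le h1 hp).trans (ENNReal.rpow_le_rpow hMG hp0.le)
  by_contra h0
  obtain ⟨M, hM, hlt⟩ := ENNReal.exists_nat_pos_mul_gt h0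
    (ENNReal.rpow_ne_top_of_nonneg hp0.le hf.ne)
  exact hlt.not_ge (hbound M hM)

/-- If `1 ≤ p < ∞`, `w ∈ A_p` and `f : ℝⁿ → ℝ` is measurable with
`f ∈ RBV^p(ℝⁿ,w)`, then `f` is (totally) differentiable at Lebesgue-a.e. point. -/
theorem statement7 (n : ℕ) (hn : 0 < n) (p : ℝ) (hp : 1 ≤ p)
    (w : Eu n → ℝ) (hw : IsWeight n w) (hA : MemAp n p w)
    (f : Eu n → ℝ) (hfm : Measurable f) (hf : rieszVar p f Set.univ w < ⊤) :
    ∀ᵐ x : Eu n ∂volume, DifferentiableAt ℝ f x := by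
  have hwm : AEMeasurable w volume := hw.2.aestronglyMeasurable.aemeasurable
  have hac : (volume : Measure (Eu n)) ≪ wMeasure n w :=
    withDensity_absolutelyContinuous' hwm.ennreal_ofReal (hA.ae_ne_zero hp hwm)
  have hlip : ∀ᵐ x : Eu n ∂volume, ∃ K : ℝ, ∀ᶠ y in 𝓝 x, |f y - f x| ≤ K * dist y x :=
    hac (wMeasure_not_pointwise_lipschitz_eq_zero hp hf)
  filter_upwards [ae_differentiableAt_of_pointwise_lipschitz volume f, hlip] with x hx h
  exact hx h
end

section
/- Reverse Hölder inequality for A_∞ weights: Let w ∈ A_p for some 1 ≤ p < ∞. Then there exists s > 1, depending on n, p, and [w]_{A_p}, such that w ∈ RH_s, i.e., [w]_{RH_s} = sup_Q (⨍_Q w^s dx)^{1/s} / (⨍_Q w dx) < ∞, the supremum taken over all cubes Q in ℝⁿ. -/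
open MeasureTheory Metric Set ENNReal Filter

section DyadicStopping

variable {α ι : Type*} [MeasurableSpace α]

/-- The points lying in some cell `ix k ⁻¹' {ix k y}` on which the `ν`-average with respect to `μ`
exceeds `l`. -/
def superlevel (μ ν : Measure α) (ix : ℕ → α → ι) (l : ℝ≥0∞) : Set α :=
  {y | ∃ k, l * μ (ix k ⁻¹' {ix k y}) < ν (ix k ⁻¹' {ix k y})}

/-- The part with index `q.2` in generation `q.1` of the points whose first cell with
average above `l` is of generation `q.1`. -/
def stoppingPiece (μ ν : Measure α) (ix : ℕ → α → ι) (l : ℝ≥0∞) (q : ℕ × ι) : Set α :=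
  {y | ix q.1 y = q.2 ∧ l * μ (ix q.1 ⁻¹' {ix q.1 y}) < ν (ix q.1 ⁻¹' {ix q.1 y}) ∧
    ∀ j < q.1, ν (ix j ⁻¹' {ix j y}) ≤ l * μ (ix j ⁻¹' {ix j y})}

theorem measure_le_of_pieces {κ : Type*} [Countable κ] (m₁ m₂ : Measure α) {E E' : Set α}
    (P : κ → Set α) (hP : ∀ i, MeasurableSet (P i)) (hd : Pairwise fun i j => Disjoint (P i) (P j))
    (hE : E ⊆ ⋃ i, P i) (hE' : ∀ i, P i ⊆ E') (h : ∀ i, m₁ (E ∩ P i) ≤ m₂ (P i)) :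
    m₁ E ≤ m₂ E' := by
  calc m₁ E ≤ m₁ (⋃ i, E ∩ P i) := by
        apply measure_mono
        rw [← inter_iUnion]
        exact fun x hx => ⟨hx, hE hx⟩
    _ ≤ ∑' i, m₁ (E ∩ P i) := measure_iUnion_le _
    _ ≤ ∑' i, m₂ (P i) := ENNReal.tsum_le_tsum h
    _ = m₂ (⋃ i, P i) := (measure_iUnion hd hP).symm
    _ ≤ m₂ E' := measure_mono (iUnion_subset hE')

variable {μ ν : Measure α} {ix : ℕ → α → ι}

theorem superlevel_subset_iUnion (l : ℝ≥0∞) :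
    superlevel μ ν ix l ⊆ ⋃ q, stoppingPiece μ ν ix l q := by
  classical
  intro y hy
  have hy' : ∃ k, l * μ (ix k ⁻¹' {ix k y}) < ν (ix k ⁻¹' {ix k y}) := hy
  refine mem_iUnion.2 ⟨(Nat.find hy', ix (Nat.find hy') y), rfl, Nat.find_spec hy', ?_⟩
  intro j hj
  exact not_lt.1 (Nat.find_min hy' hj)

theorem stoppingPiece_subset (l : ℝ≥0∞) (q : ℕ × ι) :
    stoppingPiece μ ν ix l q ⊆ superlevel μ ν ix l :=
  fun _ hy => ⟨q.1, hy.2.1⟩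

theorem stoppingPiece_disjoint (l : ℝ≥0∞) :
    Pairwise fun i j => Disjoint (stoppingPiece μ ν ix l i) (stoppingPiece μ ν ix l j) := by
  intro q q' hqq
  rw [Set.disjoint_left]
  rintro y ⟨h1, h2, h3⟩ ⟨h1', h2', h3'⟩
  apply hqq
  have : q.1 = q'.1 := by
    rcases lt_trichotomy q.1 q'.1 with h | h | h
    · exact absurd h2 (not_lt.2 (h3' _ h))
    · exact h
    · exact absurd h2' (not_lt.2 (h3 _ h))
  refine Prod.ext this ?_
  rw [← h1, ← h1', this]

omit [MeasurableSpace α] in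
theorem index_eq_of_le (hnest : ∀ k x y, ix (k + 1) x = ix (k + 1) y → ix k x = ix k y)
    {j k : ℕ} (hjk : j ≤ k) {x y : α} (h : ix k x = ix k y) : ix j x = ix j y := by
  induction k, hjk using Nat.le_induction with
  | base => exact h
  | succ k _ ih => exact ih (hnest _ _ _ h)

theorem stoppingPiece_eq (hnest : ∀ k x y, ix (k + 1) x = ix (k + 1) y → ix k x = ix k y)
    {l : ℝ≥0∞} {q : ℕ × ι} {y : α} (hy : y ∈ stoppingPiece μ ν ix l q) :
    stoppingPiece μ ν ix l q = ix q.1 ⁻¹' {ix q.1 y} := by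
  obtain ⟨h1, h2, h3⟩ := hy
  ext z
  constructor
  · rintro ⟨h1', -, -⟩
    simp [h1, h1']
  · intro hz
    have hz : ix q.1 z = ix q.1 y := hz
    refine ⟨hz.trans h1, by rwa [hz], fun j hj => ?_⟩
    rw [index_eq_of_le hnest hj.le hz]
    exact h3 j hj

theorem measurableSet_stoppingPiece (hmeas : ∀ k m, MeasurableSet (ix k ⁻¹' {m}))
    (hnest : ∀ k x y, ix (k + 1) x = ix (k + 1) y → ix k x = ix k y) (l : ℝ≥0∞) (q : ℕ × ι) :
    MeasurableSet (stoppingPiece μ ν ix l q) := by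
  rcases (stoppingPiece μ ν ix l q).eq_empty_or_nonempty with h | ⟨y, hy⟩
  · rw [h]; exact MeasurableSet.empty
  · rw [stoppingPiece_eq hnest hy]; exact hmeas _ _

theorem measurableSet_superlevel [Countable ι] (hmeas : ∀ k m, MeasurableSet (ix k ⁻¹' {m}))
    (hnest : ∀ k x y, ix (k + 1) x = ix (k + 1) y → ix k x = ix k y) (l : ℝ≥0∞) :
    MeasurableSet (superlevel μ ν ix l) := by
  rw [(superlevel_subset_iUnion l).antisymm (iUnion_subset (stoppingPiece_subset l))]
  exact MeasurableSet.iUnion fun q => measurableSet_stoppingPiece hmeas hnest l q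

/-- Weak type estimate for the dyadic maximal function inside a cell none of whose strict
ancestors has average above `l`. -/
theorem mul_measure_superlevel_inter_le [Countable ι]
    (hmeas : ∀ k m, MeasurableSet (ix k ⁻¹' {m}))
    (hnest : ∀ k x y, ix (k + 1) x = ix (k + 1) y → ix k x = ix k y) (l : ℝ≥0∞) (k : ℕ) (x : α)
    (hx : ∀ j < k, ν (ix j ⁻¹' {ix j x}) ≤ l * μ (ix j ⁻¹' {ix j x})) :
    l * μ (superlevel μ ν ix l ∩ ix k ⁻¹' {ix k x}) ≤ ν (ix k ⁻¹' {ix k x}) := by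
  set Q := ix k ⁻¹' {ix k x} with hQ
  have key := measure_le_of_pieces (l • μ) ν (E := superlevel μ ν ix l ∩ Q) (E' := Q)
    (fun q => stoppingPiece μ ν ix l q ∩ Q)
    (fun q => (measurableSet_stoppingPiece hmeas hnest l q).inter (hmeas _ _))
    (fun q q' h => (stoppingPiece_disjoint l h).mono inter_subset_left inter_subset_left)
    (by rw [← iUnion_inter]; exact inter_subset_inter_left _ (superlevel_subset_iUnion l))
    (fun q => inter_subset_right) ?_
  · simpa using key
  intro q
  rcases (stoppingPiece μ ν ix l q ∩ Q).eq_empty_or_nonempty with h | ⟨y, hy, hyQ⟩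
  · simp [h]
  have hyQ' : ix k y = ix k x := hyQ
  have hkq : k ≤ q.1 := by
    by_contra! hlt
    refine absurd hy.2.1 (not_lt.2 ?_)
    rw [index_eq_of_le hnest hlt.le hyQ']
    exact hx _ hlt
  have hsub : stoppingPiece μ ν ix l q ∩ Q = ix q.1 ⁻¹' {ix q.1 y} := by
    rw [stoppingPiece_eq hnest hy]
    refine inter_eq_left.2 fun z hz => ?_
    exact (index_eq_of_le hnest hkq hz).trans hyQ'
  calc (l • μ) (superlevel μ ν ix l ∩ Q ∩ (stoppingPiece μ ν ix l q ∩ Q))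
      ≤ (l • μ) (stoppingPiece μ ν ix l q ∩ Q) := measure_mono inter_subset_right
    _ = l * μ (ix q.1 ⁻¹' {ix q.1 y}) := by rw [hsub]; simp
    _ ≤ ν (ix q.1 ⁻¹' {ix q.1 y}) := hy.2.1.le
    _ = _ := by rw [hsub]

theorem measure_superlevel_mul_le [Countable ι]
    (hmeas : ∀ k m, MeasurableSet (ix k ⁻¹' {m}))
    (hnest : ∀ k x y, ix (k + 1) x = ix (k + 1) y → ix k x = ix k y)
    (hμ : ∀ k x, μ (ix k ⁻¹' {ix k x}) ≠ ⊤) (hν : ∀ k x, ν (ix k ⁻¹' {ix k x}) ≠ ⊤)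
    {D Λ : ℝ≥0∞} (hD1 : 1 ≤ D) (hDt : D ≠ ⊤)
    (hD : ∀ k x, μ (ix k ⁻¹' {ix k x}) ≤ D * μ (ix (k + 1) ⁻¹' {ix (k + 1) x}))
    (hA : ∀ k x F, MeasurableSet F → F ⊆ ix k ⁻¹' {ix k x} →
      μ (ix k ⁻¹' {ix k x}) ≤ 2 * μ F → ν (ix k ⁻¹' {ix k x}) ≤ Λ * ν F)
    {l : ℝ≥0∞} (hl0 : l ≠ 0) (hlt : l ≠ ⊤) (x₀ : α)
    (hx₀ : ν (ix 0 ⁻¹' {ix 0 x₀}) ≤ l * μ (ix 0 ⁻¹' {ix 0 x₀})) :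
    ν (superlevel μ ν ix (2 * D * l) ∩ ix 0 ⁻¹' {ix 0 x₀}) ≤
      (1 - Λ⁻¹) * ν (superlevel μ ν ix l ∩ ix 0 ⁻¹' {ix 0 x₀}) := by
  set Q₀ := ix 0 ⁻¹' {ix 0 x₀} with hQ₀
  have hll : l ≤ 2 * D * l := by
    calc l = 1 * 1 * l := by simp
      _ ≤ 2 * D * l := by gcongr; exact one_le_two
  have hmono : superlevel μ ν ix (2 * D * l) ⊆ superlevel μ ν ix l := by
    rintro y ⟨k, hk⟩
    exact ⟨k, lt_of_le_of_lt (by gcongr) hk⟩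
  have key := measure_le_of_pieces ν ((1 - Λ⁻¹) • ν) (E := superlevel μ ν ix (2 * D * l) ∩ Q₀)
    (E' := superlevel μ ν ix l ∩ Q₀) (fun q => stoppingPiece μ ν ix l q ∩ Q₀)
    (fun q => (measurableSet_stoppingPiece hmeas hnest l q).inter (hmeas _ _))
    (fun q q' h => (stoppingPiece_disjoint l h).mono inter_subset_left inter_subset_left)
    (by
      rw [← iUnion_inter]
      exact inter_subset_inter_left _ (hmono.trans (superlevel_subset_iUnion l)))
    (fun q => inter_subset_inter_left _ (stoppingPiece_subset l q)) ?_
  · simpa using key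
  intro q
  rcases (stoppingPiece μ ν ix l q ∩ Q₀).eq_empty_or_nonempty with h | ⟨y, hy, hyQ⟩
  · simp [h]
  have hyQ' : ix 0 y = ix 0 x₀ := hyQ
  have hq0 : q.1 ≠ 0 := by
    intro h0
    refine absurd hy.2.1 (not_lt.2 ?_)
    rw [h0, hyQ']
    exact hx₀
  obtain ⟨k, hk⟩ := Nat.exists_eq_succ_of_ne_zero hq0
  have hsub : stoppingPiece μ ν ix l q ∩ Q₀ = ix q.1 ⁻¹' {ix q.1 y} := by
    rw [stoppingPiece_eq hnest hy]
    refine inter_eq_left.2 fun z hz => ?_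
    exact (index_eq_of_le hnest (Nat.zero_le _) hz).trans hyQ'
  set Q := ix q.1 ⁻¹' {ix q.1 y} with hQ
  set E := superlevel μ ν ix (2 * D * l) ∩ Q with hE
  have hEm : MeasurableSet E := (measurableSet_superlevel hmeas hnest _).inter (hmeas _ _)
  have hEQ : E ⊆ Q := inter_subset_right
  have hμE : 2 * μ E ≤ μ Q := by
    have h1 : 2 * D * l * μ E ≤ ν Q := by
      refine mul_measure_superlevel_inter_le hmeas hnest _ _ _ fun j hj => ?_
      exact (hy.2.2 j hj).trans (by gcongr)
    have h2 : ν Q ≤ l * (D * μ Q) := by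
      calc ν Q ≤ ν (ix k ⁻¹' {ix k y}) := by
            apply measure_mono
            intro z hz
            exact index_eq_of_le hnest (by omega) hz
        _ ≤ l * μ (ix k ⁻¹' {ix k y}) := hy.2.2 k (by omega)
        _ ≤ l * (D * μ Q) := by
            gcongr
            have := hD k y
            rwa [show k + 1 = q.1 from hk.symm] at this
    have h3 : (D * l) * (2 * μ E) ≤ (D * l) * μ Q := by
      calc (D * l) * (2 * μ E) = 2 * D * l * μ E := by ring
        _ ≤ l * (D * μ Q) := h1.trans h2
        _ = _ := by ring
    exact (ENNReal.mul_le_mul_iff_right (mul_ne_zero (by positivity) hl0)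
      (ENNReal.mul_ne_top hDt hlt)).1 h3
  have hμF : μ Q ≤ 2 * μ (Q \ E) := by
    have hEt : μ E ≠ ⊤ := ne_top_of_le_ne_top (hμ _ _) (measure_mono hEQ)
    have hs : μ E + μ (Q \ E) = μ Q := by
      rw [← measure_inter_add_sdiff Q hEm, inter_eq_right.2 hEQ]
    have : μ Q + μ Q ≤ μ Q + 2 * μ (Q \ E) := by
      calc μ Q + μ Q = 2 * μ E + 2 * μ (Q \ E) := by rw [← mul_add, hs, two_mul]
        _ ≤ _ := by gcongr
    exact (ENNReal.add_le_add_iff_left (hμ _ _)).1 this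
  have hνF : ν Q ≤ Λ * ν (Q \ E) := hA _ _ _ ((hmeas _ _).diff hEm) sdiff_subset hμF
  have hνE : ν E ≤ (1 - Λ⁻¹) * ν Q := by
    have h1 : Λ⁻¹ * ν Q ≤ ν (Q \ E) := by
      rw [mul_comm, ← div_eq_mul_inv]
      exact ENNReal.div_le_of_le_mul' hνF
    have hs : ν E + ν (Q \ E) = ν Q := by
      rw [← measure_inter_add_sdiff Q hEm, inter_eq_right.2 hEQ]
    have hFt : ν (Q \ E) ≠ ⊤ := ne_top_of_le_ne_top (hν _ _) (measure_mono sdiff_subset)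
    calc ν E = ν Q - ν (Q \ E) := by rw [← hs, ENNReal.add_sub_cancel_right hFt]
      _ ≤ ν Q - Λ⁻¹ * ν Q := by gcongr
      _ = _ := by rw [ENNReal.sub_mul fun _ _ => hν _ _, one_mul]
  calc ν (superlevel μ ν ix (2 * D * l) ∩ Q₀ ∩ (stoppingPiece μ ν ix l q ∩ Q₀))
      ≤ ν E := by
        rw [hsub]
        exact measure_mono fun z hz => ⟨hz.1.1, hz.2⟩
    _ ≤ (1 - Λ⁻¹) * ν Q := hνE
    _ = _ := by rw [hsub]; simp

/-- Abstract reverse Hölder inequality on a cell of a nested sequence of partitions. -/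
theorem lintegral_rpow_le_of_cells [Countable ι]
    (hmeas : ∀ k m, MeasurableSet (ix k ⁻¹' {m}))
    (hnest : ∀ k x y, ix (k + 1) x = ix (k + 1) y → ix k x = ix k y)
    (hμ0 : ∀ k x, μ (ix k ⁻¹' {ix k x}) ≠ 0) (hν0 : ∀ k x, ν (ix k ⁻¹' {ix k x}) ≠ 0)
    (hμ : ∀ k x, μ (ix k ⁻¹' {ix k x}) ≠ ⊤) (hν : ∀ k x, ν (ix k ⁻¹' {ix k x}) ≠ ⊤)
    {D Λ K : ℝ≥0∞} (hK : K ≠ 0) (hD1 : 1 ≤ D) (hDt : D ≠ ⊤)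
    (hD : ∀ k x, μ (ix k ⁻¹' {ix k x}) ≤ D * μ (ix (k + 1) ⁻¹' {ix (k + 1) x}))
    (hA : ∀ k x F, MeasurableSet F → F ⊆ ix k ⁻¹' {ix k x} →
      μ (ix k ⁻¹' {ix k x}) ≤ 2 * μ F → ν (ix k ⁻¹' {ix k x}) ≤ Λ * ν F)
    {f : α → ℝ≥0∞} (hf : ∀ᵐ y ∂ν, ∀ l, l ≠ ⊤ → y ∉ superlevel μ ν ix l → f y ≤ K * l)
    {ε : ℝ} (hε : 0 < ε) (x₀ : α) :
    ∫⁻ y in ix 0 ⁻¹' {ix 0 x₀}, f y ^ ε ∂ν ≤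
      K ^ ε * (1 + (2 * D) ^ ε * (1 - (2 * D) ^ ε * (1 - Λ⁻¹))⁻¹) *
      (ν (ix 0 ⁻¹' {ix 0 x₀}) / μ (ix 0 ⁻¹' {ix 0 x₀})) ^ ε * ν (ix 0 ⁻¹' {ix 0 x₀}) := by
  set Q := ix 0 ⁻¹' {ix 0 x₀} with hQ
  set l := ν Q / μ Q with hl
  have hl0 : l ≠ 0 := (ENNReal.div_pos (hν0 _ _) (hμ _ _)).ne'
  have hlt : l ≠ ⊤ := ENNReal.div_ne_top (hν _ _) (hμ0 _ _)
  set a := 2 * D with ha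
  have ha1 : 1 ≤ a := by
    calc (1 : ℝ≥0∞) = 1 * 1 := by simp
      _ ≤ 2 * D := by gcongr; exact one_le_two
  have hat : a ≠ ⊤ := ENNReal.mul_ne_top (by simp) hDt
  have hakt : ∀ k : ℕ, a ^ k * l ≠ ⊤ := fun k => ENNReal.mul_ne_top (ENNReal.pow_ne_top hat) hlt
  set S : ℕ → Set α := fun k => superlevel μ ν ix (a ^ k * l) ∩ Q with hS
  have hSm : ∀ k, MeasurableSet (S k) := fun k =>
    (measurableSet_superlevel hmeas hnest _).inter (hmeas _ _)
  have hdecay : ∀ k, ν (S k) ≤ (1 - Λ⁻¹) ^ k * ν Q := by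
    intro k
    induction k with
    | zero => simpa using measure_mono inter_subset_right
    | succ k ih =>
      have hstep := measure_superlevel_mul_le hmeas hnest hμ hν hD1 hDt hD hA
        (l := a ^ k * l) (mul_ne_zero (pow_ne_zero _ (by positivity)) hl0) (hakt k) x₀ (by
          have : ν Q = l * μ Q := (ENNReal.div_mul_cancel (hμ0 _ _) (hμ _ _)).symm
          calc ν Q = 1 * l * μ Q := by rw [this, one_mul]
            _ ≤ a ^ k * l * μ Q := by gcongr; exact one_le_pow₀ ha1)
      calc ν (S (k + 1)) ≤ (1 - Λ⁻¹) * ν (S k) := by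
            rw [← mul_assoc, ← ha, ← pow_succ'] at hstep
            exact hstep
        _ ≤ (1 - Λ⁻¹) * ((1 - Λ⁻¹) ^ k * ν Q) := by gcongr
        _ = _ := by ring
  have hpt : ∀ᵐ y ∂(ν.restrict Q), f y ^ ε ≤
      (K * l) ^ ε * (1 + ∑' k, (a ^ ε) ^ (k + 1) * (S k).indicator 1 y) := by
    filter_upwards [ae_restrict_of_ae hf, ae_restrict_mem (hmeas _ _)] with y hy hyQ
    by_cases hall : ∀ k, y ∈ S k
    · have : ∑' k, (a ^ ε) ^ (k + 1) * (S k).indicator (1 : α → ℝ≥0∞) y = ⊤ := by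
        rw [eq_top_iff, ← ENNReal.tsum_const_eq_top_of_ne_zero (α := ℕ) (one_ne_zero)]
        refine ENNReal.tsum_le_tsum fun k => ?_
        simp only [hall k, indicator_of_mem, Pi.one_apply, mul_one]
        exact one_le_pow₀ (ENNReal.one_le_rpow ha1 hε)
      rw [this, add_top]
      rw [ENNReal.mul_top]
      · exact le_top
      · exact (ENNReal.rpow_pos_of_nonneg (by positivity) hε.le).ne'
    · classical
      push Not at hall
      have hk := Nat.find_spec hall
      have hmin : ∀ j < Nat.find hall, y ∈ S j := fun j hj => by
        simpa using Nat.find_min hall hj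
      generalize Nat.find hall = k at hk hmin
      have hfy : f y ≤ K * (a ^ k * l) := hy _ (hakt k) fun h => hk ⟨h, hyQ⟩
      have hfy' : f y ^ ε ≤ (K * l) ^ ε * (a ^ ε) ^ k := by
        calc f y ^ ε ≤ (K * (a ^ k * l)) ^ ε := by gcongr
          _ = ((K * l) * a ^ k) ^ ε := by ring_nf
          _ = _ := by
            rw [ENNReal.mul_rpow_of_nonneg _ _ hε.le, ← ENNReal.rpow_natCast a k,
              ← ENNReal.rpow_natCast (a ^ ε) k, ← ENNReal.rpow_mul, ← ENNReal.rpow_mul,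
              mul_comm ε]
      refine hfy'.trans ?_
      gcongr
      cases k with
      | zero => simp
      | succ j =>
        refine le_trans ?_ le_add_self
        refine le_trans ?_ (ENNReal.le_tsum j)
        simp [hmin j (by omega)]
  calc ∫⁻ y in Q, f y ^ ε ∂ν
      ≤ ∫⁻ y in Q, (K * l) ^ ε * (1 + ∑' k, (a ^ ε) ^ (k + 1) * (S k).indicator 1 y) ∂ν :=
        lintegral_mono_ae hpt
    _ = (K * l) ^ ε * (ν Q + ∑' k, (a ^ ε) ^ (k + 1) * ν (S k)) := by
        have hm : ∀ k, Measurable fun y =>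
            (a ^ ε) ^ (k + 1) * (S k).indicator (1 : α → ℝ≥0∞) y := fun k =>
          (measurable_one.indicator (hSm k)).const_mul _
        have hms : Measurable fun y =>
            ∑' k, (a ^ ε) ^ (k + 1) * (S k).indicator (1 : α → ℝ≥0∞) y := Measurable.tsum hm
        rw [lintegral_const_mul _ (by fun_prop), lintegral_add_left (measurable_const (a := (1 : ℝ≥0∞))), lintegral_tsum fun k => (hm k).aemeasurable]
        congr 2
        · simp
        · congr 1
          ext k
          rw [lintegral_const_mul _ (measurable_one.indicator (hSm k)),
            lintegral_indicator_one (hSm k), Measure.restrict_apply (hSm k),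
            inter_eq_left.2 inter_subset_right]
    _ ≤ (K * l) ^ ε * (ν Q + ∑' k, (a ^ ε) ^ (k + 1) * ((1 - Λ⁻¹) ^ k * ν Q)) := by
        gcongr with k
        exact hdecay k
    _ = (K * l) ^ ε * (ν Q + a ^ ε * ν Q * ∑' k, (a ^ ε * (1 - Λ⁻¹)) ^ k) := by
        rw [← ENNReal.tsum_mul_left]
        congr 3
        ext k
        ring
    _ = _ := by
        rw [ENNReal.tsum_geometric, ENNReal.mul_rpow_of_nonneg _ _ hε.le]
        ring

end DyadicStopping

section Muckenhoupt

variable {n : ℕ} {p Cw : ℝ} {w : Eu n → ℝ}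

theorem IsWeight.aemeasurable (hw : IsWeight n w) :
    AEMeasurable (fun y => ENNReal.ofReal (w y)) volume :=
  hw.2.aestronglyMeasurable.aemeasurable.ennreal_ofReal

theorem wMeasure_apply (w : Eu n → ℝ) (F : Set (Eu n)) :
    wMeasure n w F = ∫⁻ y in F, ENNReal.ofReal (w y) :=
  withDensity_apply' _ F

theorem IsWeight.wMeasure_closedBall_lt_top (hw : IsWeight n w) (x : Eu n) (r : ℝ) :
    wMeasure n w (closedBall x r) < ⊤ := by
  rw [wMeasure_apply]
  exact (hw.2.integrableOn_isCompact (isCompact_closedBall x r)).lintegral_lt_top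

theorem IsWeight.isLocallyFiniteMeasure (hw : IsWeight n w) :
    IsLocallyFiniteMeasure (wMeasure n w) :=
  ⟨fun x => ⟨closedBall x 1, closedBall_mem_nhds x one_pos, hw.wMeasure_closedBall_lt_top x 1⟩⟩

theorem IsMuckenhoupt.essSup_mul_wMeasure_le (hA : IsMuckenhoupt n 1 w Cw) {x : Eu n} {R : ℝ}
    (hR : 0 < R) :
    essSup (fun y => (ENNReal.ofReal (w y))⁻¹) (volume.restrict (ball x R)) *
      wMeasure n w (ball x R) ≤ ENNReal.ofReal Cw * volume (ball x R) := by
  have h := hA.2.1 rfl x R hR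
  rw [setLAverage_eq, ← mul_div_assoc, ← wMeasure_apply] at h
  exact (ENNReal.div_le_iff (measure_ball_pos _ _ hR).ne' measure_ball_lt_top.ne).1 h

theorem IsMuckenhoupt.wMeasure_mul_rpow_le (hp : 1 < p) (hA : IsMuckenhoupt n p w Cw)
    {x : Eu n} {R : ℝ} (hR : 0 < R) :
    wMeasure n w (ball x R) *
      (∫⁻ y in ball x R, ENNReal.ofReal (w y) ^ (1 / (1 - p))) ^ (p - 1) ≤
      ENNReal.ofReal Cw * volume (ball x R) ^ p := by
  have h := hA.2.2 hp x R hR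
  have hB0 : volume (ball x R) ≠ 0 := (measure_ball_pos _ _ hR).ne'
  have hBt : volume (ball x R) ≠ ⊤ := measure_ball_lt_top.ne
  rw [setLAverage_eq, setLAverage_eq, ENNReal.div_rpow_of_nonneg _ _ (by linarith), div_eq_mul_inv,
    div_eq_mul_inv, mul_mul_mul_comm, ← ENNReal.mul_inv (Or.inl hB0) (Or.inl hBt),
    ← div_eq_mul_inv, ← wMeasure_apply] at h
  have hpow : volume (ball x R) * volume (ball x R) ^ (p - 1) = volume (ball x R) ^ p := by
    nth_rewrite 1 [← ENNReal.rpow_one (volume (ball x R))]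
    rw [← ENNReal.rpow_add _ _ hB0 hBt]
    ring_nf
  rw [hpow] at h
  exact (ENNReal.div_le_iff (ENNReal.rpow_pos (pos_iff_ne_zero.2 hB0) hBt).ne'
    (ENNReal.rpow_ne_top_of_nonneg (by linarith) hBt)).1 h

/-- The comparability of the `w`-measure and the Lebesgue measure of large subsets of a ball. -/
theorem IsMuckenhoupt.wMeasure_ball_le (hp : 1 ≤ p) (hw : IsWeight n w)
    (hA : IsMuckenhoupt n p w Cw) {x : Eu n} {R : ℝ} (hR : 0 < R) {F : Set (Eu n)}
    (hFB : F ⊆ ball x R) {θ : ℝ≥0∞}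
    (h : volume (ball x R) ≤ θ * volume F) :
    wMeasure n w (ball x R) ≤ ENNReal.ofReal Cw * θ ^ p * wMeasure n w F := by
  set f : Eu n → ℝ≥0∞ := fun y => ENNReal.ofReal (w y) with hf
  set B := ball x R with hB
  have hp0 : 0 < p := by linarith
  have hB0 : volume B ≠ 0 := (measure_ball_pos _ _ hR).ne'
  have hBt : volume B ≠ ⊤ := measure_ball_lt_top.ne
  have hFt : volume F ≠ ⊤ := ne_top_of_le_ne_top hBt (measure_mono hFB)
  have hF0 : volume F ≠ 0 := by
    intro h0
    rw [h0, mul_zero] at h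
    exact hB0 (le_zero_iff.1 h)
  have hν0 : wMeasure n w B ≠ 0 := by
    rw [wMeasure_apply]
    exact (hA.1 x R hR).ne'
  have hle : volume.restrict F ≤ (volume.restrict B : Measure (Eu n)) :=
    Measure.restrict_mono hFB le_rfl
  have key : wMeasure n w B * volume F ^ p ≤
      ENNReal.ofReal Cw * volume B ^ p * wMeasure n w F := by
    rcases hp.eq_or_lt with rfl | hp1
    · have h1 := hA.essSup_mul_wMeasure_le (x := x) hR
      set M := essSup (fun y => (ENNReal.ofReal (w y))⁻¹) (volume.restrict (ball x R)) with hM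
      have hMt : M ≠ ⊤ := by
        intro hM'
        rw [hM', ENNReal.top_mul hν0] at h1
        exact (ENNReal.mul_lt_top ENNReal.ofReal_lt_top hBt.lt_top).not_ge h1
      have h2 : volume F ≤ M * wMeasure n w F := by
        rw [wMeasure_apply, ← lintegral_const_mul'' _ hw.aemeasurable.restrict,
          ← setLIntegral_one]
        refine lintegral_mono_ae ((ae_mono hle) ?_)
        filter_upwards [ENNReal.ae_le_essSup (μ := volume.restrict B)
          (fun y => (ENNReal.ofReal (w y))⁻¹)] with y hy
        have hy0 : ENNReal.ofReal (w y) ≠ 0 := by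
          intro h0
          rw [h0, ENNReal.inv_zero, top_le_iff] at hy
          exact hMt hy
        calc (1 : ℝ≥0∞) = (ENNReal.ofReal (w y))⁻¹ * ENNReal.ofReal (w y) :=
              (ENNReal.inv_mul_cancel hy0 ENNReal.ofReal_ne_top).symm
          _ ≤ M * ENNReal.ofReal (w y) := by gcongr
      rw [ENNReal.rpow_one, ENNReal.rpow_one]
      calc wMeasure n w B * volume F ≤ wMeasure n w B * (M * wMeasure n w F) := by gcongr
        _ = M * wMeasure n w B * wMeasure n w F := by ring
        _ ≤ _ := by gcongr
    · have h1 := hA.wMeasure_mul_rpow_le hp1 (x := x) hR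
      set S := ∫⁻ y in ball x R, ENNReal.ofReal (w y) ^ (1 / (1 - p)) with hS
      have hSt : S ≠ ⊤ := by
        intro hS'
        rw [hS', ENNReal.top_rpow_of_pos (by linarith), ENNReal.mul_top hν0] at h1
        exact (ENNReal.mul_lt_top ENNReal.ofReal_lt_top
          (ENNReal.rpow_lt_top_of_nonneg hp0.le hBt)).not_ge h1
      have hpq : p.HolderConjugate (p / (p - 1)) := Real.HolderConjugate.conjExponent hp1
      have h2 : volume F ≤ wMeasure n w F ^ (1 / p) * S ^ (1 / (p / (p - 1))) := by
        have hH := ENNReal.lintegral_mul_le_Lp_mul_Lq (volume.restrict F) hpq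
          (f := fun y => f y ^ (1 / p)) (g := fun y => f y ^ (-(1 / p)))
          (hw.aemeasurable.restrict.pow_const _) (hw.aemeasurable.restrict.pow_const _)
        have e1 : ∀ y, (f y ^ (1 / p)) ^ p = f y := fun y => by
          rw [← ENNReal.rpow_mul, one_div_mul_cancel hp0.ne', ENNReal.rpow_one]
        have e2 : ∀ y, (f y ^ (-(1 / p))) ^ (p / (p - 1)) = f y ^ (1 / (1 - p)) := fun y => by
          rw [← ENNReal.rpow_mul]
          congr 1
          have : p - 1 ≠ 0 := by linarith
          have : 1 - p ≠ 0 := by linarith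
          field_simp
          ring
        simp only [e1, e2] at hH
        rw [← wMeasure_apply] at hH
        refine le_trans ?_ (hH.trans (mul_le_mul_right (ENNReal.rpow_le_rpow
          (lintegral_mono' hle le_rfl) (by positivity [hpq.symm.nonneg])) _))
        rw [← setLIntegral_one]
        refine lintegral_mono_ae ((ae_mono hle) ?_)
        have hfin := ae_lt_top' (hw.aemeasurable.restrict.pow_const (1 / (1 - p))) hSt
        filter_upwards [hfin] with y hy
        have hy0 : f y ≠ 0 := by
          intro h0
          change f y ^ (1 / (1 - p)) < ⊤ at hy
          rw [h0, ENNReal.zero_rpow_of_neg (one_div_neg.2 (by linarith))] at hy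
          exact lt_irrefl _ hy
        rw [Pi.mul_apply, ← ENNReal.rpow_add _ _ hy0 ENNReal.ofReal_ne_top]
        simp
      have h3 : volume F ^ p ≤ wMeasure n w F * S ^ (p - 1) := by
        calc volume F ^ p ≤ (wMeasure n w F ^ (1 / p) * S ^ (1 / (p / (p - 1)))) ^ p := by
              gcongr
          _ = _ := by
            rw [ENNReal.mul_rpow_of_nonneg _ _ hp0.le, ← ENNReal.rpow_mul, ← ENNReal.rpow_mul,
              one_div_mul_cancel hp0.ne', ENNReal.rpow_one]
            congr 2
            field_simp
      calc wMeasure n w B * volume F ^ p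
          ≤ wMeasure n w B * (wMeasure n w F * S ^ (p - 1)) := by gcongr
        _ = wMeasure n w B * S ^ (p - 1) * wMeasure n w F := by ring
        _ ≤ _ := by gcongr
  have hFp0 : volume F ^ p ≠ 0 := (ENNReal.rpow_pos (pos_iff_ne_zero.2 hF0) hFt).ne'
  have hFpt : volume F ^ p ≠ ⊤ := ENNReal.rpow_ne_top_of_nonneg hp0.le hFt
  refine (ENNReal.mul_le_mul_iff_left hFp0 hFpt).1 (key.trans ?_)
  calc ENNReal.ofReal Cw * volume B ^ p * wMeasure n w F
      ≤ ENNReal.ofReal Cw * (θ * volume F) ^ p * wMeasure n w F := by gcongr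
    _ = _ := by
      rw [ENNReal.mul_rpow_of_nonneg _ _ hp0.le]
      ring

end Muckenhoupt

section DyadicGrid

variable {n : ℕ}

/-- The index of the cube of generation `k` containing `y`, in the dyadic grid with corner `a`
and initial side length `ℓ`. -/
noncomputable def dyadicIndex (a : Eu n) (ℓ : ℝ) (k : ℕ) (y : Eu n) : Fin n → ℤ :=
  fun i => ⌊2 ^ k * ((y i - a i) / ℓ)⌋

theorem dyadicIndex_nested (a : Eu n) (ℓ : ℝ) (k : ℕ) (x y : Eu n)
    (h : dyadicIndex a ℓ (k + 1) x = dyadicIndex a ℓ (k + 1) y) :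
    dyadicIndex a ℓ k x = dyadicIndex a ℓ k y := by
  have key : ∀ z : Eu n, ∀ i, dyadicIndex a ℓ k z i = dyadicIndex a ℓ (k + 1) z i / 2 := by
    intro z i
    have := Int.floor_div_natCast (2 ^ (k + 1) * ((z i - a i) / ℓ)) 2
    push_cast at this
    rw [dyadicIndex, dyadicIndex, ← this]
    congr 1
    ring
  ext i
  rw [key, key, h]

theorem dyadicIndex_preimage (a : Eu n) {ℓ : ℝ} (hℓ : 0 < ℓ) (k : ℕ) (m : Fin n → ℤ) :
    dyadicIndex a ℓ k ⁻¹' {m} = WithLp.ofLp ⁻¹' (univ.pi fun i =>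
      Ico (a i + m i * (ℓ / 2 ^ k)) (a i + m i * (ℓ / 2 ^ k) + ℓ / 2 ^ k)) := by
  ext y
  simp only [mem_preimage, mem_singleton_iff, funext_iff, Set.mem_pi, mem_univ, forall_const,
    dyadicIndex, Int.floor_eq_iff, mem_Ico]
  refine forall_congr' fun i => ?_
  have e : (2 : ℝ) ^ k * ((y i - a i) / ℓ) = (y i - a i) / (ℓ / 2 ^ k) := by field_simp
  have h : 0 < ℓ / 2 ^ k := by positivity
  rw [e, le_div_iff₀ h, div_lt_iff₀ h, add_mul, one_mul]
  constructor <;> rintro ⟨h1, h2⟩ <;> constructor <;> linarith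

theorem measurableSet_dyadicIndex_preimage (a : Eu n) {ℓ : ℝ} (hℓ : 0 < ℓ) (k : ℕ)
    (m : Fin n → ℤ) : MeasurableSet (dyadicIndex a ℓ k ⁻¹' {m}) := by
  rw [dyadicIndex_preimage a hℓ]
  exact (PiLp.volume_preserving_ofLp (Fin n)).measurable
    (MeasurableSet.univ_pi fun _ => measurableSet_Ico)

theorem volume_dyadicIndex_preimage (a : Eu n) {ℓ : ℝ} (hℓ : 0 < ℓ) (k : ℕ)
    (m : Fin n → ℤ) :
    volume (dyadicIndex a ℓ k ⁻¹' {m}) = ENNReal.ofReal (ℓ / 2 ^ k) ^ n := by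
  rw [dyadicIndex_preimage a hℓ, (PiLp.volume_preserving_ofLp (Fin n)).measure_preimage
    (MeasurableSet.univ_pi fun _ => measurableSet_Ico).nullMeasurableSet, volume_pi_pi]
  simp

theorem dyadicIndex_preimage_subset_ball (a : Eu n) {ℓ : ℝ} (hℓ : 0 < ℓ) (k : ℕ) (y : Eu n) :
    dyadicIndex a ℓ k ⁻¹' {dyadicIndex a ℓ k y} ⊆ ball y ((n + 1) * (ℓ / 2 ^ k)) := by
  intro z hz
  have h : 0 < ℓ / 2 ^ k := by positivity
  have hy : y ∈ dyadicIndex a ℓ k ⁻¹' {dyadicIndex a ℓ k y} := rfl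
  rw [dyadicIndex_preimage a hℓ] at hy hz
  have hd : ∀ i, dist (z i) (y i) ^ 2 ≤ (ℓ / 2 ^ k) ^ 2 := by
    intro i
    have h1 := hz i (mem_univ i)
    have h2 := hy i (mem_univ i)
    rw [Real.dist_eq, sq_abs]
    refine sq_le_sq' ?_ ?_ <;> linarith [h1.1, h1.2, h2.1, h2.2]
  rw [mem_ball, EuclideanSpace.dist_eq, Real.sqrt_lt' (by positivity)]
  calc ∑ i, dist (z i) (y i) ^ 2 ≤ ∑ _i : Fin n, (ℓ / 2 ^ k) ^ 2 :=
        Finset.sum_le_sum fun i _ => hd i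
    _ = n * (ℓ / 2 ^ k) ^ 2 := by simp
    _ < ((n + 1) * (ℓ / 2 ^ k)) ^ 2 := by
        rw [mul_pow]
        gcongr
        nlinarith [(n.cast_nonneg : (0 : ℝ) ≤ n)]

theorem volume_ball_eq (y : Eu n) {c h : ℝ} (hc : 0 < c) (hh : 0 < h) :
    volume (ball y (c * h)) =
      ENNReal.ofReal c ^ n * volume (ball (0 : Eu n) 1) * ENNReal.ofReal h ^ n := by
  rw [Measure.addHaar_ball_of_pos _ _ (mul_pos hc hh), finrank_euclideanSpace_fin, mul_pow,
    ENNReal.ofReal_mul (by positivity), ENNReal.ofReal_pow hc.le, ENNReal.ofReal_pow hh.le]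
  ring

theorem ball_subset_dyadicIndex_preimage (x : Eu n) {r : ℝ} (hr : 0 < r) :
    ball x r ⊆ dyadicIndex (WithLp.toLp 2 fun i => x i - r) (2 * r) 0 ⁻¹'
      {dyadicIndex (WithLp.toLp 2 fun i => x i - r) (2 * r) 0 x} := by
  have key : ∀ y ∈ ball x r, ∀ i,
      dyadicIndex (WithLp.toLp 2 fun i => x i - r) (2 * r) 0 y i = 0 := by
    intro y hy i
    have h1 : |y i - x i| < r := by
      have := (PiLp.norm_apply_le (y - x) i).trans_lt (mem_ball_iff_norm.1 hy)
      simpa using this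
    rw [abs_lt] at h1
    rw [dyadicIndex, Int.floor_eq_iff]
    have h2 : 0 < 2 * r := by positivity
    simp only [pow_zero, one_mul, Int.cast_zero, zero_add, div_lt_one h2]
    refine ⟨div_nonneg ?_ h2.le, ?_⟩ <;> linarith
  intro y hy
  ext i
  rw [key y hy, key x (mem_ball_self hr)]

end DyadicGrid

section ReverseHolder

variable {n : ℕ} {p Cw : ℝ} {w : Eu n → ℝ}

theorem exists_rpow_mul_lt_one {a η : ℝ≥0∞} (ha0 : a ≠ 0) (hat : a ≠ ⊤) (hη : η < 1) :
    ∃ ε : ℝ, 0 < ε ∧ a ^ ε * η < 1 := by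
  have hc : Continuous fun ε : ℝ => a.toReal ^ ε * η.toReal :=
    (Real.continuous_const_rpow (ENNReal.toReal_pos ha0 hat).ne').mul continuous_const
  have h0 : a.toReal ^ (0 : ℝ) * η.toReal < 1 := by
    rw [Real.rpow_zero, one_mul]
    simpa using (ENNReal.toReal_lt_toReal hη.ne_top one_ne_top).2 hη
  obtain ⟨ε, hε, hε0⟩ := (((hc.tendsto 0).eventually (gt_mem_nhds h0)).filter_mono
    nhdsWithin_le_nhds |>.and (self_mem_nhdsWithin (s := Ioi (0 : ℝ)))).exists
  refine ⟨ε, hε0, ?_⟩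
  rw [← ENNReal.toReal_lt_toReal (ENNReal.mul_ne_top
    (ENNReal.rpow_ne_top_of_nonneg (le_of_lt hε0) hat) hη.ne_top) one_ne_top, ENNReal.toReal_mul,
    ← ENNReal.toReal_rpow]
  simpa using hε

/-- The ratio of the volume of a ball of radius `2 (n + 1) h` to that of a cube of side `h`. -/
noncomputable def ballCubeRatio (n : ℕ) : ℝ≥0∞ :=
  ENNReal.ofReal (2 * (n + 1)) ^ n * volume (ball (0 : Eu n) 1)

theorem ballCubeRatio_ne_top (n : ℕ) : ballCubeRatio n ≠ ⊤ :=
  ENNReal.mul_ne_top (ENNReal.pow_ne_top ENNReal.ofReal_ne_top) measure_ball_lt_top.ne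

/-- The constant comparing the `w`-measure of a cube with that of a subset of at least half its
volume. -/
noncomputable def cubeConst (n : ℕ) (p Cw : ℝ) : ℝ≥0∞ :=
  max (ENNReal.ofReal Cw * (2 * ballCubeRatio n) ^ p) 1

theorem cubeConst_ne_top (n : ℕ) (hp : 1 ≤ p) (Cw : ℝ) : cubeConst n p Cw ≠ ⊤ :=
  (max_lt (ENNReal.mul_lt_top ENNReal.ofReal_lt_top (ENNReal.rpow_lt_top_of_nonneg (by linarith)
    (ENNReal.mul_ne_top (by simp) (ballCubeRatio_ne_top n)))) one_lt_top).ne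

theorem cubeConst_ne_zero (n : ℕ) (p Cw : ℝ) : cubeConst n p Cw ≠ 0 :=
  (zero_lt_one.trans_le (le_max_right _ _)).ne'

theorem dyadicIndex_preimage_subset_ball_two (a : Eu n) {ℓ : ℝ} (hℓ : 0 < ℓ) (k : ℕ) (y : Eu n) :
    dyadicIndex a ℓ k ⁻¹' {dyadicIndex a ℓ k y} ⊆ ball y (2 * (n + 1) * (ℓ / 2 ^ k)) := by
  refine (dyadicIndex_preimage_subset_ball a hℓ k y).trans (ball_subset_ball ?_)
  have : 0 ≤ ((n : ℝ) + 1) * (ℓ / 2 ^ k) := by positivity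
  linarith

theorem IsMuckenhoupt.wMeasure_ball_le_of_subset_cube (hp : 1 ≤ p) (hw : IsWeight n w)
    (hA : IsMuckenhoupt n p w Cw) (a : Eu n) {ℓ : ℝ} (hℓ : 0 < ℓ) (k : ℕ) (y : Eu n)
    {F : Set (Eu n)} (hF : F ⊆ dyadicIndex a ℓ k ⁻¹' {dyadicIndex a ℓ k y})
    (h : volume (dyadicIndex a ℓ k ⁻¹' {dyadicIndex a ℓ k y}) ≤ 2 * volume F) :
    wMeasure n w (ball y (2 * (n + 1) * (ℓ / 2 ^ k))) ≤ cubeConst n p Cw * wMeasure n w F := by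
  have hh : 0 < ℓ / 2 ^ k := by positivity
  refine (hA.wMeasure_ball_le hp hw (θ := 2 * ballCubeRatio n) (by positivity)
    (hF.trans (dyadicIndex_preimage_subset_ball_two a hℓ k y)) ?_).trans ?_
  · rw [volume_ball_eq y (by positivity) hh, ← volume_dyadicIndex_preimage a hℓ k
      (dyadicIndex a ℓ k y), ← ballCubeRatio]
    calc _ ≤ ballCubeRatio n * (2 * volume F) := by gcongr
      _ = _ := by ring
  · gcongr
    exact le_max_left _ _

theorem IsMuckenhoupt.ae_le_of_notMem_superlevel (hp : 1 ≤ p) (hw : IsWeight n w)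
    (hA : IsMuckenhoupt n p w Cw) (a : Eu n) {ℓ : ℝ} (hℓ : 0 < ℓ) :
    ∀ᵐ y ∂wMeasure n w, ∀ l, l ≠ ⊤ →
      y ∉ superlevel volume (wMeasure n w) (dyadicIndex a ℓ) l →
        ENNReal.ofReal (w y) ≤ cubeConst n p Cw * l := by
  have := hw.isLocallyFiniteMeasure
  have hac : wMeasure n w ≪ volume := withDensity_absolutelyContinuous _ _
  refine hac.ae_le ?_
  filter_upwards [Besicovitch.ae_tendsto_rnDeriv (wMeasure n w) (volume : Measure (Eu n)),
    Measure.rnDeriv_withDensity₀ (volume : Measure (Eu n)) hw.aemeasurable] with y hy hy' l _ hl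
  change (wMeasure n w).rnDeriv volume y = _ at hy'
  rw [hy'] at hy
  have hR : Tendsto (fun k : ℕ => ((n : ℝ) + 1) * (ℓ / 2 ^ k)) atTop (nhdsWithin 0 (Ioi 0)) := by
    refine tendsto_nhdsWithin_iff.2 ⟨?_, Eventually.of_forall fun k => ?_⟩
    · have h1 := (tendsto_pow_atTop_nhds_zero_of_lt_one (r := (1 / 2 : ℝ)) (by norm_num)
        (by norm_num)).const_mul (((n : ℝ) + 1) * ℓ)
      rw [mul_zero] at h1
      refine h1.congr fun k => ?_
      rw [div_pow, one_pow]
      ring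
    · exact mem_Ioi.2 (by positivity)
  refine le_of_tendsto (hy.comp hR) (Eventually.of_forall fun k => ?_)
  set Q := dyadicIndex a ℓ k ⁻¹' {dyadicIndex a ℓ k y} with hQ
  set R := ((n : ℝ) + 1) * (ℓ / 2 ^ k) with hRdef
  have hRpos : 0 < R := by positivity
  have hQl : wMeasure n w Q ≤ l * volume Q := by
    by_contra! hlt
    exact hl ⟨k, hlt⟩
  refine ENNReal.div_le_of_le_mul ?_
  calc wMeasure n w (closedBall y R)
      ≤ wMeasure n w (ball y (2 * (n + 1) * (ℓ / 2 ^ k))) :=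
        measure_mono (closedBall_subset_ball (by linarith))
    _ ≤ cubeConst n p Cw * wMeasure n w Q := by
        refine hA.wMeasure_ball_le_of_subset_cube hp hw a hℓ k y Subset.rfl ?_
        rw [two_mul]
        exact le_self_add
    _ ≤ cubeConst n p Cw * (l * volume Q) := by gcongr
    _ ≤ cubeConst n p Cw * (l * volume (closedBall y R)) := by
        gcongr
        exact (dyadicIndex_preimage_subset_ball a hℓ k y).trans ball_subset_closedBall
    _ = _ := by ring

/-- The factor in the reverse Hölder inequality on cubes. -/
noncomputable def cubeFactor (n : ℕ) (p Cw ε : ℝ) : ℝ≥0∞ :=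
  cubeConst n p Cw ^ ε * (1 + (2 * 2 ^ n) ^ ε *
    (1 - (2 * 2 ^ n) ^ ε * (1 - (cubeConst n p Cw)⁻¹))⁻¹)

theorem IsMuckenhoupt.lintegral_cube_rpow_le (hp : 1 ≤ p) (hw : IsWeight n w)
    (hA : IsMuckenhoupt n p w Cw) (a : Eu n) {ℓ : ℝ} (hℓ : 0 < ℓ) {ε : ℝ} (hε : 0 < ε)
    (x : Eu n) :
    ∫⁻ y in dyadicIndex a ℓ 0 ⁻¹' {dyadicIndex a ℓ 0 x}, ENNReal.ofReal (w y) ^ (1 + ε) ≤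
      cubeFactor n p Cw ε *
      (wMeasure n w (dyadicIndex a ℓ 0 ⁻¹' {dyadicIndex a ℓ 0 x}) /
        volume (dyadicIndex a ℓ 0 ⁻¹' {dyadicIndex a ℓ 0 x})) ^ ε *
      wMeasure n w (dyadicIndex a ℓ 0 ⁻¹' {dyadicIndex a ℓ 0 x}) := by
  have hvol : ∀ k y, volume (dyadicIndex a ℓ k ⁻¹' {dyadicIndex a ℓ k y}) ≤
      2 * volume (dyadicIndex a ℓ k ⁻¹' {dyadicIndex a ℓ k y}) := fun k y => by
    rw [two_mul]
    exact le_self_add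
  have hmain := lintegral_rpow_le_of_cells (μ := (volume : Measure (Eu n)))
    (ν := wMeasure n w) (ix := dyadicIndex a ℓ) (D := 2 ^ n) (Λ := cubeConst n p Cw)
    (K := cubeConst n p Cw)
    (measurableSet_dyadicIndex_preimage a hℓ) (dyadicIndex_nested a ℓ)
    (fun k y => by
      rw [volume_dyadicIndex_preimage a hℓ]
      exact pow_ne_zero _ (ENNReal.ofReal_pos.2 (by positivity)).ne')
    (fun k y h0 => by
      have h1 := hA.wMeasure_ball_le_of_subset_cube hp hw a hℓ k y Subset.rfl (hvol k y)
      rw [h0, mul_zero, wMeasure_apply] at h1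
      exact (hA.1 y _ (by positivity)).not_ge h1)
    (fun k y => by
      rw [volume_dyadicIndex_preimage a hℓ]
      exact ENNReal.pow_ne_top ENNReal.ofReal_ne_top)
    (fun k y => ne_top_of_le_ne_top (hw.wMeasure_closedBall_lt_top y _).ne
      (measure_mono ((dyadicIndex_preimage_subset_ball a hℓ k y).trans ball_subset_closedBall)))
    (cubeConst_ne_zero n p Cw) (one_le_pow₀ one_le_two) (ENNReal.pow_ne_top (by simp))
    (fun k y => by
      rw [volume_dyadicIndex_preimage a hℓ, volume_dyadicIndex_preimage a hℓ, ← mul_pow,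
        ← ENNReal.ofReal_ofNat 2, ← ENNReal.ofReal_mul (by norm_num), pow_succ]
      refine le_of_eq ?_
      congr 2
      field_simp)
    (fun k y F _ hFQ h => (measure_mono (dyadicIndex_preimage_subset_ball_two a hℓ k y)).trans
      (hA.wMeasure_ball_le_of_subset_cube hp hw a hℓ k y hFQ h))
    (hA.ae_le_of_notMem_superlevel hp hw a hℓ) hε x
  refine le_trans (le_of_eq ?_) hmain
  rw [wMeasure, restrict_withDensity (measurableSet_dyadicIndex_preimage a hℓ 0 _),
    lintegral_withDensity_eq_lintegral_mul₀' hw.aemeasurable.restrict]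
  · refine lintegral_congr fun y => ?_
    rw [Pi.mul_apply, ENNReal.rpow_add_of_nonneg _ _ zero_le_one hε.le, ENNReal.rpow_one]
  · exact (hw.aemeasurable.restrict.pow_const ε).mono_ac (withDensity_absolutelyContinuous _ _)

end ReverseHolder

/-- reverse Hölder inequality. If `w ∈ A_p`, `1 ≤ p < ∞`, with
`[w]_{A_p} ≤ Cw`, then there is `s > 1`, depending only on `n`, `p` and `Cw`, such that
`w ∈ RH_s`: for some constant `CR` and all balls `B`, `(⨍_B w^s)^{1/s} ≤ CR ⨍_B w`. -/
theorem statement12 (n : ℕ) (hn : 0 < n) (p Cw : ℝ) (hp : 1 ≤ p) :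
    ∃ s : ℝ, 1 < s ∧
      ∀ w : Eu n → ℝ, IsWeight n w → IsMuckenhoupt n p w Cw →
        ∃ CR : ℝ≥0∞, CR < ⊤ ∧
          ∀ (x : Eu n) (r : ℝ), 0 < r →
            (⨍⁻ y in ball x r, ENNReal.ofReal (w y) ^ s ∂volume) ^ (1 / s) ≤
              CR * ⨍⁻ y in ball x r, ENNReal.ofReal (w y) ∂volume := by
  have hη : 1 - (cubeConst n p Cw)⁻¹ < 1 :=
    ENNReal.sub_lt_self one_ne_top one_ne_zero (ENNReal.inv_ne_zero.2 (cubeConst_ne_top n hp Cw))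
  have ha0 : (2 * 2 ^ n : ℝ≥0∞) ≠ 0 := by positivity
  have hat : (2 * 2 ^ n : ℝ≥0∞) ≠ ⊤ := ENNReal.mul_ne_top (by simp) (ENNReal.pow_ne_top (by simp))
  obtain ⟨ε, hε, hlt⟩ := exists_rpow_mul_lt_one ha0 hat hη
  have hs : 0 < 1 + ε := by linarith
  set G := cubeFactor n p Cw ε with hG
  have hGt : G ≠ ⊤ := by
    refine ENNReal.mul_ne_top (ENNReal.rpow_ne_top_of_nonneg hε.le (cubeConst_ne_top n hp Cw))
      (ENNReal.add_ne_top.2 ⟨one_ne_top, ENNReal.mul_ne_top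
        (ENNReal.rpow_ne_top_of_nonneg hε.le hat) (ENNReal.inv_ne_top.2 ?_)⟩)
    exact (tsub_pos_of_lt hlt).ne'
  set M := ENNReal.ofReal Cw * (ENNReal.ofReal (4 * (n + 1)) ^ n) ^ p with hM
  have hMt : M ≠ ⊤ := ENNReal.mul_ne_top ENNReal.ofReal_ne_top
    (ENNReal.rpow_ne_top_of_nonneg (by linarith) (ENNReal.pow_ne_top ENNReal.ofReal_ne_top))
  refine ⟨1 + ε, by linarith, fun w hw hA => ⟨(G * M ^ (1 + ε)) ^ (1 / (1 + ε)),
    ENNReal.rpow_lt_top_of_nonneg (by positivity)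
      (ENNReal.mul_ne_top hGt (ENNReal.rpow_ne_top_of_nonneg hs.le hMt)), fun x r hr => ?_⟩⟩
  set B := ball x r with hB
  have hB0 : volume B ≠ 0 := (measure_ball_pos _ _ hr).ne'
  have hBt : volume B ≠ ⊤ := measure_ball_lt_top.ne
  set a : Eu n := WithLp.toLp 2 fun i => x i - r with ha
  have hℓ : 0 < 2 * r := by positivity
  set Q := dyadicIndex a (2 * r) 0 ⁻¹' {dyadicIndex a (2 * r) 0 x} with hQ
  have hBQ : B ⊆ Q := ball_subset_dyadicIndex_preimage x hr
  have hνQ : wMeasure n w Q ≤ M * wMeasure n w B := by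
    have hsub := dyadicIndex_preimage_subset_ball_two a hℓ 0 x
    have hrad : 2 * ((n : ℝ) + 1) * (2 * r / 2 ^ 0) = 4 * (n + 1) * r := by ring
    rw [hrad] at hsub
    have hn4 : 0 < 4 * ((n : ℝ) + 1) := by positivity
    refine (measure_mono hsub).trans (hA.wMeasure_ball_le hp hw (by positivity)
      (ball_subset_ball ?_) ?_)
    · nlinarith [(n.cast_nonneg : (0 : ℝ) ≤ n)]
    · have hBv : volume (ball x r) = volume (ball (0 : Eu n) 1) * ENNReal.ofReal r ^ n := by
        simpa using volume_ball_eq x one_pos hr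
      rw [volume_ball_eq x hn4 hr, hBv, mul_assoc]
  have hint : ∫⁻ y in B, ENNReal.ofReal (w y) ^ (1 + ε) ≤
      G * (M * (wMeasure n w B / volume B)) ^ ε * (M * wMeasure n w B) := by
    calc ∫⁻ y in B, ENNReal.ofReal (w y) ^ (1 + ε)
        ≤ ∫⁻ y in Q, ENNReal.ofReal (w y) ^ (1 + ε) := lintegral_mono_set hBQ
      _ ≤ G * (wMeasure n w Q / volume Q) ^ ε * wMeasure n w Q :=
          hA.lintegral_cube_rpow_le hp hw a hℓ hε x
      _ ≤ G * (M * wMeasure n w B / volume B) ^ ε * (M * wMeasure n w B) := by gcongr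
      _ = _ := by rw [mul_div_assoc]
  rw [setLAverage_eq, setLAverage_eq, ← wMeasure_apply]
  set A := wMeasure n w B / volume B with hAdef
  have hle : (∫⁻ y in B, ENNReal.ofReal (w y) ^ (1 + ε)) / volume B ≤
      G * M ^ (1 + ε) * A ^ (1 + ε) := by
    refine (ENNReal.div_le_div_right hint _).trans (le_of_eq ?_)
    rw [mul_assoc G (M ^ (1 + ε)), ← ENNReal.mul_rpow_of_nonneg _ _ hs.le,
      ENNReal.rpow_add_of_nonneg _ _ zero_le_one hε.le, ENNReal.rpow_one, mul_div_assoc,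
      mul_div_assoc, ← hAdef]
    ring
  calc ((∫⁻ y in B, ENNReal.ofReal (w y) ^ (1 + ε)) / volume B) ^ (1 / (1 + ε))
      ≤ (G * M ^ (1 + ε) * A ^ (1 + ε)) ^ (1 / (1 + ε)) := by gcongr
    _ = _ := by
      rw [ENNReal.mul_rpow_of_nonneg _ _ (by positivity), ← ENNReal.rpow_mul A,
        mul_one_div_cancel hs.ne', ENNReal.rpow_one]
end
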